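/- arXiv:2310.08264 — 4 statements merged into one kernel-verified Lean document; each statement's English description precedes it below -/
import Mathlib

section
/- Let n ≥ 2 and 0 < μ < n. Suppose u ∈ C²(ℝⁿ) satisfies 0 ≤ −Δu(x) ≤ C₀ for all x ∈ ℝⁿ (for some constant C₀ > 0) and ∫_{ℝⁿ} e^{((2n−μ)/2) u(y)} dy < ∞. Then there exists a constant C > 0 such that u(x) ≤ C for all x ∈ ℝⁿ. -/
open MeasureTheory Real Filter Metric

noncomputable section

/-- The nonlocal term `v(x) = ∫ e^{((2n-μ)/2) u(y)} / |x-y|^μ dy`. -/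
noncomputable def V (n : ℕ) (μ : ℝ) (u : EuclideanSpace ℝ (Fin n) → ℝ)
    (x : EuclideanSpace ℝ (Fin n)) : ℝ :=
  ∫ y : EuclideanSpace ℝ (Fin n),
    Real.exp ((2 * n - μ) / 2 * u y) / ‖x - y‖ ^ μ

/-- `βₙ = 2^{n-1} Γ(n/2+1) Γ(n/2) ωₙ` with `ωₙ` the volume of the unit ball in `ℝⁿ`. -/
noncomputable def betaN (n : ℕ) : ℝ :=
  2 ^ (n - 1) * Real.Gamma ((n : ℝ) / 2 + 1) * Real.Gamma ((n : ℝ) / 2) *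
    (volume (Metric.ball (0 : EuclideanSpace ℝ (Fin n)) 1)).toReal

/-- Condition (B): finite weighted volume and finite total curvature. -/
def CondB (n : ℕ) (μ : ℝ) (u : EuclideanSpace ℝ (Fin n) → ℝ) : Prop :=
  Integrable (fun y : EuclideanSpace ℝ (Fin n) => Real.exp ((2 * n - μ) / 2 * u y)) ∧
  Integrable (fun p : EuclideanSpace ℝ (Fin n) × EuclideanSpace ℝ (Fin n) =>
    Real.exp ((2 * n - μ) / 2 * u p.1) * Real.exp ((2 * n - μ) / 2 * u p.2) / ‖p.1 - p.2‖ ^ μ)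

/-- The integral equation (IE). -/
def IE (n : ℕ) (μ : ℝ) (u : EuclideanSpace ℝ (Fin n) → ℝ) : Prop :=
  ∃ C : ℝ, ∀ x : EuclideanSpace ℝ (Fin n), u x = (1 / betaN n) *
    (∫ y, Real.log ((‖y‖ + 1) / ‖x - y‖) * (V n μ u y * Real.exp ((2 * n - μ) / 2 * u y))) + C

/-- `α = (1/βₙ) ∫ v(y) e^{((2n-μ)/2) u(y)} dy`. -/
noncomputable def alphaC (n : ℕ) (μ : ℝ) (u : EuclideanSpace ℝ (Fin n) → ℝ) : ℝ :=
  (1 / betaN n) * ∫ y, V n μ u y * Real.exp ((2 * n - μ) / 2 * u y)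

/-- The Laplacian of `f : ℝⁿ → ℝ` computed coordinatewise via Fréchet derivatives. -/
noncomputable def lap (n : ℕ) (f : EuclideanSpace ℝ (Fin n) → ℝ)
    (x : EuclideanSpace ℝ (Fin n)) : ℝ :=
  ∑ i : Fin n,
    fderiv ℝ (fun y => fderiv ℝ f y (EuclideanSpace.single i (1 : ℝ))) x
      (EuclideanSpace.single i (1 : ℝ))

/-- The `k`-fold iterate of the negative Laplacian `(-Δ)^k`. -/
noncomputable def negLapIter (n k : ℕ) (f : EuclideanSpace ℝ (Fin n) → ℝ) :
    EuclideanSpace ℝ (Fin n) → ℝ :=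
  (fun g x => -(lap n g x))^[k] f

/-- The squared positive part is differentiable, with derivative twice the positive part. -/
theorem hasDerivAt_max_zero_sq (t : ℝ) :
    HasDerivAt (fun s : ℝ => max s 0 ^ 2) (2 * max t 0) t := by
  rw [hasDerivAt_iff_isLittleO]
  have hbound : ∀ s : ℝ,
      ‖max s 0 ^ 2 - max t 0 ^ 2 - (s - t) • (2 * max t 0)‖ ≤ ‖(s - t) ^ 2‖ := by
    intro s
    rw [Real.norm_eq_abs, Real.norm_eq_abs, abs_of_nonneg (sq_nonneg (s - t)), abs_le, smul_eq_mul]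
    rcases le_total s 0 with hs | hs <;> rcases le_total t 0 with ht | ht <;>
      simp only [max_eq_left, max_eq_right, hs, ht] <;> constructor <;> nlinarith
  refine (Asymptotics.IsBigO.of_norm_le hbound).trans_isLittleO ?_
  simpa using Asymptotics.isLittleO_pow_sub_sub t one_lt_two

section WeightedMeans

variable {n : ℕ}

local notation "𝔼" => EuclideanSpace ℝ (Fin n)

/-- The compactly supported weight `(1 - ‖y‖²)₊`. -/
def parabolicWeight (y : 𝔼) : ℝ := max (1 - ‖y‖ ^ 2) 0

theorem continuous_parabolicWeight : Continuous (parabolicWeight (n := n)) := by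
  unfold parabolicWeight
  fun_prop

theorem parabolicWeight_nonneg (y : 𝔼) : 0 ≤ parabolicWeight y := le_max_right _ _

theorem parabolicWeight_le_one (y : 𝔼) : parabolicWeight y ≤ 1 :=
  max_le (by nlinarith [sq_nonneg ‖y‖]) zero_le_one

theorem parabolicWeight_eq_zero {y : 𝔼} (hy : 1 ≤ ‖y‖) : parabolicWeight y = 0 :=
  max_eq_right (by nlinarith)

theorem hasCompactSupport_parabolicWeight : HasCompactSupport (parabolicWeight (n := n)) :=
  HasCompactSupport.intro (isCompact_closedBall 0 1) fun y hy => by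
    rw [mem_closedBall_zero_iff, not_le] at hy
    exact parabolicWeight_eq_zero hy.le

theorem hasCompactSupport_parabolicWeight_sq :
    HasCompactSupport (fun y : 𝔼 => parabolicWeight y ^ 2) :=
  hasCompactSupport_parabolicWeight.comp_left (g := fun t : ℝ => t ^ 2) (by simp)

theorem integrable_mul_parabolicWeight {f : 𝔼 → ℝ} (hf : Continuous f) :
    Integrable (fun y => f y * parabolicWeight y) :=
  (hf.mul continuous_parabolicWeight).integrable_of_hasCompactSupport
    hasCompactSupport_parabolicWeight.mul_left

theorem integrable_mul_parabolicWeight_sq {f : 𝔼 → ℝ} (hf : Continuous f) :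
    Integrable (fun y => f y * parabolicWeight y ^ 2) :=
  (hf.mul (continuous_parabolicWeight.pow 2)).integrable_of_hasCompactSupport
    hasCompactSupport_parabolicWeight_sq.mul_left

theorem integrable_parabolicWeight : Integrable (parabolicWeight (n := n)) :=
  continuous_parabolicWeight.integrable_of_hasCompactSupport hasCompactSupport_parabolicWeight

theorem integral_parabolicWeight_pos : 0 < ∫ y : 𝔼, parabolicWeight y :=
  continuous_parabolicWeight.integral_pos_of_hasCompactSupport_nonneg_nonzero
    hasCompactSupport_parabolicWeight parabolicWeight_nonneg
    (x := 0) (by simp [parabolicWeight])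

theorem hasFDerivAt_parabolicWeight_sq (y : 𝔼) :
    HasFDerivAt (fun z : 𝔼 => parabolicWeight z ^ 2)
      ((-4 * parabolicWeight y) • innerSL ℝ y) y := by
  have hnorm : HasFDerivAt (fun z : 𝔼 => 1 - ‖z‖ ^ 2) (-(2 • innerSL ℝ y)) y :=
    (hasStrictFDerivAt_norm_sq y).hasFDerivAt.const_sub 1
  have hcoeff : (-4 * parabolicWeight y) • innerSL ℝ y =
      (2 * max (1 - ‖y‖ ^ 2) 0) • -(2 • innerSL ℝ y) := by
    ext v
    simp [parabolicWeight]
    ring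
  rw [hcoeff]
  exact (hasDerivAt_max_zero_sq (1 - ‖y‖ ^ 2)).comp_hasFDerivAt y hnorm

theorem integral_mul_parabolicWeight_by_parts {g : 𝔼 → ℝ} (hg : ContDiff ℝ 1 g) (v : 𝔼) :
    ∫ y, 4 * (g y * inner ℝ y v) * parabolicWeight y =
      ∫ y, fderiv ℝ g y v * parabolicWeight y ^ 2 := by
  have hfd : ∀ y, g y * fderiv ℝ (fun z : 𝔼 => parabolicWeight z ^ 2) y v =
      -(4 * (g y * inner ℝ y v) * parabolicWeight y) := fun y => by
    rw [(hasFDerivAt_parabolicWeight_sq y).fderiv]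
    simp
    ring
  have hcont := hg.continuous
  have key := integral_mul_fderiv_eq_neg_fderiv_mul_of_integrable (μ := volume) (v := v)
    (f := g) (g := fun z : 𝔼 => parabolicWeight z ^ 2)
    (integrable_mul_parabolicWeight_sq ((hg.continuous_fderiv one_ne_zero).clm_apply
      continuous_const))
    (by
      simp only [hfd]
      exact (integrable_mul_parabolicWeight (by fun_prop)).neg)
    (integrable_mul_parabolicWeight_sq hg.continuous)
    (fun y _ => hg.differentiable one_ne_zero y)
    (fun y _ => (hasFDerivAt_parabolicWeight_sq y).differentiableAt)
  simp only [hfd, integral_neg] at key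
  exact neg_injective key

theorem integral_radial_deriv_mul_parabolicWeight {u : 𝔼 → ℝ} (hu : ContDiff ℝ 2 u) (x : 𝔼)
    (r : ℝ) :
    ∫ y, fderiv ℝ u (x + r • y) y * parabolicWeight y =
      r / 4 * ∫ y, lap n u (x + r • y) * parabolicWeight y ^ 2 := by
  have hpartial : ∀ i : Fin n,
      ContDiff ℝ 1 (fun z => fderiv ℝ u z (EuclideanSpace.single i (1 : ℝ))) := fun i =>
    (hu.fderiv_right (by norm_num)).clm_apply contDiff_const
  have haff : ContDiff ℝ 1 (fun y : 𝔼 => x + r • y) := by fun_prop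
  have hparts : ∀ i : Fin n,
      ∫ y : 𝔼, 4 * (fderiv ℝ u (x + r • y) (EuclideanSpace.single i (1 : ℝ)) * y i) *
        parabolicWeight y =
      ∫ y : 𝔼, r * fderiv ℝ (fun z => fderiv ℝ u z (EuclideanSpace.single i (1 : ℝ))) (x + r • y)
        (EuclideanSpace.single i (1 : ℝ)) * parabolicWeight y ^ 2 := fun i => by
    have h := integral_mul_parabolicWeight_by_parts ((hpartial i).comp haff)
      (EuclideanSpace.single i (1 : ℝ))
    have hchain : ∀ y : 𝔼,
        fderiv ℝ ((fun z => fderiv ℝ u z (EuclideanSpace.single i (1 : ℝ))) ∘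
          fun y : 𝔼 => x + r • y) y (EuclideanSpace.single i (1 : ℝ)) =
        r * fderiv ℝ (fun z => fderiv ℝ u z (EuclideanSpace.single i (1 : ℝ))) (x + r • y)
          (EuclideanSpace.single i (1 : ℝ)) := fun y => by
      have hinner : HasFDerivAt (fun y : 𝔼 => x + r • y) (r • ContinuousLinearMap.id ℝ 𝔼) y :=
        ((hasFDerivAt_id y).const_smul r).const_add x
      rw [((((hpartial i).differentiable one_ne_zero) (x + r • y)).hasFDerivAt.comp y
        hinner).fderiv]
      simp
    simp only [hchain] at h
    simpa [EuclideanSpace.inner_single_right] using h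
  have hexpand : ∀ y : 𝔼, fderiv ℝ u (x + r • y) y * parabolicWeight y =
      ∑ i, 1 / 4 * (4 * (fderiv ℝ u (x + r • y) (EuclideanSpace.single i (1 : ℝ)) * y i) *
        parabolicWeight y) := fun y => by
    have hy : ∑ i, y i • EuclideanSpace.single i (1 : ℝ) = y := by
      simpa using (EuclideanSpace.basisFun (Fin n) ℝ).sum_repr y
    conv_lhs => enter [1, 2]; rw [← hy]
    rw [map_sum, Finset.sum_mul]
    refine Finset.sum_congr rfl fun i _ => ?_
    rw [map_smul, smul_eq_mul]
    ring
  have hsecond : ∀ i : Fin n, Continuous (fun y : 𝔼 =>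
      fderiv ℝ (fun z => fderiv ℝ u z (EuclideanSpace.single i (1 : ℝ))) (x + r • y)
        (EuclideanSpace.single i (1 : ℝ))) := fun i =>
    (((hpartial i).continuous_fderiv one_ne_zero).clm_apply continuous_const).comp haff.continuous
  have hfirst : ∀ i : Fin n, Continuous (fun y : 𝔼 =>
      fderiv ℝ u (x + r • y) (EuclideanSpace.single i (1 : ℝ))) := fun i =>
    (hpartial i).continuous.comp haff.continuous
  simp only [hexpand]
  rw [integral_finsetSum _ fun i _ => ?_]
  · simp only [integral_const_mul, hparts, lap, Finset.sum_mul]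
    rw [integral_finsetSum _ fun i _ => integrable_mul_parabolicWeight_sq (hsecond i),
      Finset.mul_sum]
    refine Finset.sum_congr rfl fun i _ => ?_
    simp only [mul_assoc, integral_const_mul]
    ring
  · have := hfirst i
    exact (integrable_mul_parabolicWeight (by fun_prop)).const_mul _

theorem hasDerivAt_integral_mul_parabolicWeight {u : 𝔼 → ℝ} (hu : ContDiff ℝ 2 u) (x : 𝔼)
    (r : ℝ) :
    HasDerivAt (fun s : ℝ => ∫ y, u (x + s • y) * parabolicWeight y)
      (∫ y, fderiv ℝ u (x + r • y) y * parabolicWeight y) r := by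
  have hcont := hu.continuous
  have hfderiv : Continuous (fderiv ℝ u) := hu.continuous_fderiv two_ne_zero
  obtain ⟨M, hM⟩ := (isCompact_closedBall x (|r| + 1)).exists_bound_of_continuousOn
    hfderiv.continuousOn
  refine (hasDerivAt_integral_of_dominated_loc_of_deriv_le (ball_mem_nhds r one_pos)
    (F' := fun s y => fderiv ℝ u (x + s • y) y * parabolicWeight y)
    (bound := fun y => M * parabolicWeight y)
    (Eventually.of_forall fun s =>
      (integrable_mul_parabolicWeight (by fun_prop)).aestronglyMeasurable)
    (integrable_mul_parabolicWeight (by fun_prop))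
    (integrable_mul_parabolicWeight (by fun_prop)).aestronglyMeasurable
    (Eventually.of_forall fun y s hs => ?_) (integrable_parabolicWeight.const_mul M)
    (Eventually.of_forall fun y s _ => ?_)).2
  · rcases le_total 1 ‖y‖ with hy | hy
    · simp [parabolicWeight_eq_zero hy]
    · have hmem : x + s • y ∈ closedBall x (|r| + 1) := by
        rw [mem_closedBall_iff_norm, add_sub_cancel_left, norm_smul, Real.norm_eq_abs]
        have hs' : |s - r| < 1 := hs
        have : |s| ≤ |r| + 1 := by linarith [abs_sub_abs_le_abs_sub s r]
        nlinarith [abs_nonneg s, norm_nonneg y]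
      rw [norm_mul, Real.norm_of_nonneg (parabolicWeight_nonneg y)]
      refine mul_le_mul_of_nonneg_right ?_ (parabolicWeight_nonneg y)
      exact (((fderiv ℝ u (x + s • y)).le_opNorm y).trans
        (mul_le_of_le_one_right (norm_nonneg _) hy)).trans (hM _ hmem)
  · have hline : HasDerivAt (fun s : ℝ => x + s • y) y s := by
      simpa using ((hasDerivAt_id s).smul_const y).const_add x
    exact (((hu.differentiable two_ne_zero) (x + s • y)).hasFDerivAt.comp_hasDerivAt s
      hline).mul_const _

/-- An approximate mean value inequality for functions whose Laplacian is bounded below. -/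
theorem mul_integral_parabolicWeight_le {u : 𝔼 → ℝ} (hu : ContDiff ℝ 2 u) {C : ℝ}
    (hC : 0 ≤ C) (hlap : ∀ z, -C ≤ lap n u z) (x : 𝔼) :
    u x * ∫ y : 𝔼, parabolicWeight y ≤
      (∫ y, u (x + y) * parabolicWeight y) + C * ∫ y : 𝔼, parabolicWeight y ^ 2 := by
  have hderiv := hasDerivAt_integral_mul_parabolicWeight hu x
  have hsq : 0 ≤ ∫ y : 𝔼, parabolicWeight y ^ 2 := integral_nonneg fun y => sq_nonneg _
  have hlapInt : ∀ r : ℝ, Integrable fun y => lap n u (x + r • y) * parabolicWeight y ^ 2 :=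
      fun r => by
    refine integrable_mul_parabolicWeight_sq (f := fun y => lap n u (x + r • y)) ?_
    unfold lap
    refine continuous_finsetSum _ fun i _ => ?_
    have h1 : ContDiff ℝ 1 (fun z => fderiv ℝ u z (EuclideanSpace.single i (1 : ℝ))) :=
      (hu.fderiv_right (by norm_num)).clm_apply contDiff_const
    exact ((h1.continuous_fderiv one_ne_zero).clm_apply continuous_const).comp (by fun_prop)
  have key := (convex_Icc (0 : ℝ) 1).mul_sub_le_image_sub_of_le_deriv
    (C := -(C * ∫ y : 𝔼, parabolicWeight y ^ 2))
    (fun r _ => (hderiv r).continuousAt.continuousWithinAt)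
    (fun r _ => (hderiv r).differentiableAt.differentiableWithinAt)
    (fun r hr => by
      rw [interior_Icc] at hr
      rw [(hderiv r).deriv, integral_radial_deriv_mul_parabolicWeight hu]
      have hle : -(C * ∫ y : 𝔼, parabolicWeight y ^ 2) ≤
          ∫ y, lap n u (x + r • y) * parabolicWeight y ^ 2 := by
        rw [← integral_const_mul, ← integral_neg]
        refine integral_mono ?_ (hlapInt r) fun y => ?_
        · exact (integrable_mul_parabolicWeight_sq continuous_const).neg
        · have := mul_le_mul_of_nonneg_right (hlap (x + r • y)) (sq_nonneg (parabolicWeight y))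
          simpa using this
      have := mul_nonneg hC hsq
      nlinarith [hr.1, hr.2])
    0 (by simp) 1 (by simp) zero_le_one
  simp only [zero_smul, one_smul, add_zero, integral_const_mul] at key
  linarith

end WeightedMeans

theorem upper_bound_from_bounded_laplacian (n : ℕ) (hn : 2 ≤ n)
    (μ : ℝ) (hμ0 : 0 < μ) (hμn : μ < n)
    (u : EuclideanSpace ℝ (Fin n) → ℝ) (hu : ContDiff ℝ 2 u)
    (C₀ : ℝ) (hC₀ : 0 < C₀)
    (hlap : ∀ x : EuclideanSpace ℝ (Fin n), 0 ≤ -lap n u x ∧ -lap n u x ≤ C₀)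
    (hInt : Integrable
      (fun y : EuclideanSpace ℝ (Fin n) => Real.exp ((2 * n - μ) / 2 * u y))) :
    ∃ C > (0 : ℝ), ∀ x : EuclideanSpace ℝ (Fin n), u x ≤ C := by
  set k : ℝ := (2 * n - μ) / 2 with hk
  have hkpos : 0 < k := by
    have : (0 : ℝ) ≤ n := Nat.cast_nonneg n
    rw [hk]
    linarith
  set A := ∫ y : EuclideanSpace ℝ (Fin n), parabolicWeight y
  set B := ∫ y : EuclideanSpace ℝ (Fin n), parabolicWeight y ^ 2
  set I := ∫ y : EuclideanSpace ℝ (Fin n), Real.exp (k * u y)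
  have hA : 0 < A := integral_parabolicWeight_pos
  have hbound : ∀ x, u x * A ≤ I / k + C₀ * B := fun x => by
    have hmean := mul_integral_parabolicWeight_le hu hC₀.le (fun z => by linarith [(hlap z).2]) x
    have hexp : ∫ y, u (x + y) * parabolicWeight y ≤
        ∫ y, Real.exp (k * u (x + y)) / k := by
      have hcont := hu.continuous
      refine integral_mono (integrable_mul_parabolicWeight (by fun_prop))
        ((hInt.comp_add_left x).div_const k) fun y => ?_
      have hle : u (x + y) ≤ Real.exp (k * u (x + y)) / k := by
        rw [le_div_iff₀ hkpos]
        linarith [Real.add_one_le_exp (k * u (x + y))]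
      calc u (x + y) * parabolicWeight y
          ≤ Real.exp (k * u (x + y)) / k * parabolicWeight y :=
            mul_le_mul_of_nonneg_right hle (parabolicWeight_nonneg y)
        _ ≤ Real.exp (k * u (x + y)) / k :=
            mul_le_of_le_one_right (by positivity) (parabolicWeight_le_one y)
    rw [integral_div, integral_add_left_eq_self (fun y => Real.exp (k * u y)) x] at hexp
    linarith
  refine ⟨max ((I / k + C₀ * B) / A) 1, lt_max_of_lt_right one_pos, fun x => le_max_of_le_left ?_⟩
  rw [le_div_iff₀ hA]
  exact hbound x
end
end

section
/- (Brezis–Merle inequality.) Let R > 0 and let B_R ⊂ ℝ² be the open ball of radius R centered at the origin. Let f ∈ L¹(B_R) with ‖f‖_{L¹(B_R)} > 0, and let h be a solution of −Δh = f in B_R with h = 0 on ∂B_R. Then for every δ ∈ (0, 4π) the inequality ∫_{B_R} exp( (4π − δ)|h(x)| / ‖f‖_{L¹(B_R)} ) dx ≤ (4π²/δ) R² holds. -/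
open MeasureTheory Real Filter Metric

noncomputable section

/-- The Laplacian of `f : ℝ² → ℝ` computed coordinatewise via Fréchet derivatives. -/
noncomputable def lap2 (f : EuclideanSpace ℝ (Fin 2) → ℝ)
    (x : EuclideanSpace ℝ (Fin 2)) : ℝ :=
  ∑ i : Fin 2,
    fderiv ℝ (fun y => fderiv ℝ f y (EuclideanSpace.single i (1 : ℝ))) x
      (EuclideanSpace.single i (1 : ℝ))

/-- The Laplacian of a function on `ℂ ≃ ℝ²`, read off from the second Fréchet derivative. -/
def complexLaplacian (h : ℂ → ℝ) (z : ℂ) : ℝ :=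
  fderiv ℝ (fderiv ℝ h) z 1 1 + fderiv ℝ (fderiv ℝ h) z Complex.I Complex.I

lemma bilin_conformal_trace (B : ℂ →L[ℝ] ℂ →L[ℝ] ℝ) (q : ℂ) :
    B q q + B (Complex.I * q) (Complex.I * q) = ‖q‖ ^ 2 * (B 1 1 + B Complex.I Complex.I) := by
  have hq : q = q.re • (1 : ℂ) + q.im • Complex.I := by
    apply Complex.ext <;> simp
  have hIq : Complex.I * q = (-q.im) • (1 : ℂ) + q.re • Complex.I := by
    apply Complex.ext <;> simp
  have hn : ‖q‖ ^ 2 = q.re ^ 2 + q.im ^ 2 := by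
    rw [← Complex.normSq_eq_norm_sq, Complex.normSq_apply]; ring
  rw [hIq, hn]
  conv_lhs => rw [hq]
  simp only [map_add, map_smul, add_apply, smul_apply,
    smul_eq_mul]
  simp
  ring

lemma hasFDerivAt_comp_holomorphic {h : ℂ → ℝ} {ψ : ℂ → ℂ} {z q : ℂ}
    (hh : DifferentiableAt ℝ h (ψ z)) (hψ : HasDerivAt ψ q z) :
    HasFDerivAt (fun z => h (ψ z)) ((fderiv ℝ h (ψ z)).comp
      ((ContinuousLinearMap.toSpanSingleton ℂ q).restrictScalars ℝ)) z :=
  hh.hasFDerivAt.comp z (hψ.hasFDerivAt.restrictScalars ℝ)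

lemma hasFDerivAt_fderiv_comp_holomorphic {h : ℂ → ℝ} {ψ q : ℂ → ℂ} {z q' : ℂ} (u : ℂ)
    (hh : DifferentiableAt ℝ (fderiv ℝ h) (ψ z)) (hψ : HasDerivAt ψ (q z) z)
    (hq : HasDerivAt q q' z) :
    ∃ L : ℂ →L[ℝ] ℝ, HasFDerivAt (fun z => fderiv ℝ h (ψ z) (u * q z)) L z ∧
      ∀ d, L d = fderiv ℝ (fderiv ℝ h) (ψ z) (d * q z) (u * q z) +
        fderiv ℝ h (ψ z) (d * (u * q')) := by
  have h1 : HasFDerivAt (fun z => fderiv ℝ h (ψ z)) _ z :=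
    hh.hasFDerivAt.comp z (hψ.hasFDerivAt.restrictScalars ℝ)
  have h2 : HasFDerivAt (fun z => u * q z) _ z :=
    (hq.const_mul u).hasFDerivAt.restrictScalars ℝ
  refine ⟨_, h1.clm_apply h2, fun d => ?_⟩
  simp
  ring

/-- Green's identity on the rectangle `[a, b] × [-π, π]` for `h ∘ ψ`, tested against `b - re z`,
where `ψ` is `2πi`-periodic and holomorphic on the left half-plane. -/
lemma integral_rectangle_laplacian_comp {U : Set ℂ} (hU : IsOpen U) {h : ℂ → ℝ}
    (hreg : ContDiffOn ℝ 2 h U) {ψ q q' : ℂ → ℂ}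
    (hψU : ∀ z : ℂ, z.re < 0 → ψ z ∈ U)
    (hψ : ∀ z : ℂ, z.re < 0 → HasDerivAt ψ (q z) z)
    (hq : ∀ z : ℂ, z.re < 0 → HasDerivAt q (q' z) z)
    (hψp : ∀ z, ψ (z + 2 * Real.pi * Complex.I) = ψ z)
    (hqp : ∀ z, q (z + 2 * Real.pi * Complex.I) = q z)
    {a b : ℝ} (hab : a ≤ b) (hb : b < 0) :
    ∫ p in Set.Icc (a, -Real.pi) (b, Real.pi),
        (b - p.1) * (‖q (p.1 + p.2 * Complex.I)‖ ^ 2 *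
          complexLaplacian h (ψ (p.1 + p.2 * Complex.I))) =
      (∫ θ in (-Real.pi)..Real.pi, h (ψ (b + θ * Complex.I))) -
      (∫ θ in (-Real.pi)..Real.pi, ((b - a) * fderiv ℝ h (ψ (a + θ * Complex.I))
        (q (a + θ * Complex.I)) + h (ψ (a + θ * Complex.I)))) := by
  set c : ℝ × ℝ →L[ℝ] ℂ := (Complex.equivRealProdCLM.symm : ℝ × ℝ →L[ℝ] ℂ) with hc
  have hcv : ∀ p : ℝ × ℝ, c p = p.1 + p.2 * Complex.I := fun p => by
    simp [hc, Complex.equivRealProdCLM_symm_apply]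
  have hc1 : c (1, 0) = 1 := by simp [hcv]
  have hc2 : c (0, 1) = Complex.I := by simp [hcv]
  have hcre : ∀ p, (c p).re = p.1 := by simp [hcv]
  have hreg1 : ContDiffOn ℝ 1 (fderiv ℝ h) U := hreg.fderiv_of_isOpen hU (by norm_num)
  have hreg2 : ContinuousOn (fderiv ℝ (fderiv ℝ h)) U :=
    hreg1.continuousOn_fderiv_of_isOpen hU le_rfl
  have hdh : ∀ z : ℂ, z.re < 0 → DifferentiableAt ℝ h (ψ z) := fun z hz =>
    (hreg.differentiableOn (by norm_num)).differentiableAt (hU.mem_nhds (hψU z hz))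
  have hdh1 : ∀ z : ℂ, z.re < 0 → DifferentiableAt ℝ (fderiv ℝ h) (ψ z) := fun z hz =>
    (hreg1.differentiableOn (by norm_num)).differentiableAt (hU.mem_nhds (hψU z hz))
  have D0 : ∀ p : ℝ × ℝ, p.1 < 0 → HasFDerivAt (fun p => h (ψ (c p)))
      (((fderiv ℝ h (ψ (c p))).comp
      ((ContinuousLinearMap.toSpanSingleton ℂ (q (c p))).restrictScalars ℝ)).comp c) p := by
    intro p hp
    exact (hasFDerivAt_comp_holomorphic (hdh _ (by rwa [hcre])) (hψ _ (by rwa [hcre]))).comp p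
      c.hasFDerivAt
  have key : ∀ (u : ℂ) (p : ℝ × ℝ), ∃ L : ℂ →L[ℝ] ℝ, p.1 < 0 →
      HasFDerivAt (fun z => fderiv ℝ h (ψ z) (u * q z)) L (c p) ∧
      ∀ d, L d = fderiv ℝ (fderiv ℝ h) (ψ (c p)) (d * q (c p)) (u * q (c p)) +
        fderiv ℝ h (ψ (c p)) (d * (u * q' (c p))) := by
    intro u p
    by_cases hp : p.1 < 0
    · have hp' : (c p).re < 0 := by rwa [hcre]
      obtain ⟨L, hL⟩ := hasFDerivAt_fderiv_comp_holomorphic u (hdh1 _ hp') (hψ _ hp') (hq _ hp')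
      exact ⟨L, fun _ => hL⟩
    · exact ⟨0, fun h => absurd h hp⟩
  choose L hL using key
  have D1 : ∀ (u : ℂ) (p : ℝ × ℝ), p.1 < 0 →
      HasFDerivAt (fun p : ℝ × ℝ => (b - p.1) * fderiv ℝ h (ψ (c p)) (u * q (c p)))
      ((b - p.1) • ((L u p).comp c) +
        (fderiv ℝ h (ψ (c p)) (u * q (c p))) • (-(ContinuousLinearMap.fst ℝ ℝ ℝ))) p := by
    intro u p hp
    have e1 : HasFDerivAt (fun p : ℝ × ℝ => b - p.1) (-(ContinuousLinearMap.fst ℝ ℝ ℝ)) p := by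
      simpa using (hasFDerivAt_fst (𝕜 := ℝ) (p := p)).const_sub b
    exact e1.mul (((hL u p hp).1).comp p c.hasFDerivAt)
  set F : ℝ × ℝ → ℝ := fun p => (b - p.1) * fderiv ℝ h (ψ (c p)) (1 * q (c p)) + h (ψ (c p))
  set G : ℝ × ℝ → ℝ := fun p => (b - p.1) * fderiv ℝ h (ψ (c p)) (Complex.I * q (c p))
  set F' : ℝ × ℝ → ℝ × ℝ →L[ℝ] ℝ := fun p => ((b - p.1) • ((L 1 p).comp c) +
        (fderiv ℝ h (ψ (c p)) (1 * q (c p))) • (-(ContinuousLinearMap.fst ℝ ℝ ℝ))) +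
        (((fderiv ℝ h (ψ (c p))).comp
      ((ContinuousLinearMap.toSpanSingleton ℂ (q (c p))).restrictScalars ℝ)).comp c)
  set G' : ℝ × ℝ → ℝ × ℝ →L[ℝ] ℝ := fun p => ((b - p.1) • ((L Complex.I p).comp c) +
        (fderiv ℝ h (ψ (c p)) (Complex.I * q (c p))) • (-(ContinuousLinearMap.fst ℝ ℝ ℝ)))
  have HF : ∀ p : ℝ × ℝ, p.1 < 0 → HasFDerivAt F (F' p) p := fun p hp =>
    (D1 1 p hp).add (D0 p hp)
  have HG : ∀ p : ℝ × ℝ, p.1 < 0 → HasFDerivAt G (G' p) p := fun p hp => D1 _ p hp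
  have hdiv : ∀ p : ℝ × ℝ, p.1 < 0 → F' p (1, 0) + G' p (0, 1) =
      (b - p.1) * (‖q (c p)‖ ^ 2 * complexLaplacian h (ψ (c p))) := by
    intro p hp
    simp only [F', G', add_apply, smul_apply,
      ContinuousLinearMap.comp_apply, hc1, hc2, (hL _ p hp).2, smul_eq_mul,
      neg_apply, complexLaplacian]
    rw [← bilin_conformal_trace]
    have : Complex.I * (Complex.I * q' (c p)) = -(q' (c p)) := by
      rw [← mul_assoc, Complex.I_mul_I]; ring
    simp [this]
    ring
  have hneg : ∀ p ∈ Set.Icc (a, -Real.pi) (b, Real.pi), p.1 < 0 := fun p hp =>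
    lt_of_le_of_lt hp.2.1 hb
  have hψc : ContinuousOn (fun p => ψ (c p)) (Set.Icc (a, -Real.pi) (b, Real.pi)) := fun p hp =>
    (((hψ _ (by rw [hcre]; exact hneg p hp)).continuousAt).comp
      c.continuous.continuousAt).continuousWithinAt
  have hqc : ContinuousOn (fun p => q (c p)) (Set.Icc (a, -Real.pi) (b, Real.pi)) := fun p hp =>
    (((hq _ (by rw [hcre]; exact hneg p hp)).continuousAt).comp
      c.continuous.continuousAt).continuousWithinAt
  have hcont : ContinuousOn (fun p : ℝ × ℝ =>
      (b - p.1) * (‖q (c p)‖ ^ 2 * complexLaplacian h (ψ (c p))))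
      (Set.Icc (a, -Real.pi) (b, Real.pi)) := by
    have h2 : ContinuousOn (fun p => fderiv ℝ (fderiv ℝ h) (ψ (c p)))
        (Set.Icc (a, -Real.pi) (b, Real.pi)) :=
      hreg2.comp hψc fun p hp => hψU _ (by rw [hcre]; exact hneg p hp)
    have h3 : ∀ u : ℂ, ContinuousOn (fun p => fderiv ℝ (fderiv ℝ h) (ψ (c p)) u u)
        (Set.Icc (a, -Real.pi) (b, Real.pi)) := fun u =>
      (h2.clm_apply continuousOn_const).clm_apply continuousOn_const
    exact (continuousOn_const.sub continuous_fst.continuousOn).mul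
      ((hqc.norm.pow 2).mul ((h3 1).add (h3 Complex.I)))
  have hcongr : Set.EqOn (fun p : ℝ × ℝ =>
      (b - p.1) * (‖q (c p)‖ ^ 2 * complexLaplacian h (ψ (c p))))
      (fun p => F' p (1, 0) + G' p (0, 1)) (Set.Icc (a, -Real.pi) (b, Real.pi)) :=
    fun p hp => (hdiv p (hneg p hp)).symm
  have hint : IntegrableOn (fun p => F' p (1, 0) + G' p (0, 1))
      (Set.Icc (a, -Real.pi) (b, Real.pi)) :=
    (hcont.integrableOn_compact isCompact_Icc).congr_fun hcongr measurableSet_Icc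
  have main := integral_divergence_prod_Icc_of_hasFDerivAt_of_le F G F' G' (a, -Real.pi)
    (b, Real.pi) ⟨hab, by simp; linarith [Real.pi_pos]⟩
    (fun p hp => (HF p (hneg p hp)).continuousAt.continuousWithinAt)
    (fun p hp => (HG p (hneg p hp)).continuousAt.continuousWithinAt)
    (fun p hp => HF p (lt_trans hp.1.2 hb)) (fun p hp => HG p (lt_trans hp.1.2 hb)) hint
  have hper : ∀ s : ℝ, G (s, Real.pi) = G (s, -Real.pi) := by
    intro s
    have e : c (s, Real.pi) = c (s, -Real.pi) + 2 * Real.pi * Complex.I := by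
      simp [hcv]; ring
    simp only [G, e, hψp, hqp]
  simp only [← hcv]
  rw [setIntegral_congr_fun measurableSet_Icc hcongr, main]
  simp only [hper, sub_self, zero_add]
  simp [F, hcv]

/-- The Möbius transformation mapping the unit disk onto the disk of radius `R` and `0` to `x`. -/
def diskMoebius (R : ℝ) (x ζ : ℂ) : ℂ :=
  R * (R * ζ + x) / (R + starRingEnd ℂ x * ζ)

/-- The derivative of `diskMoebius`. -/
def diskMoebiusDeriv (R : ℝ) (x ζ : ℂ) : ℂ :=
  R * (R ^ 2 - x * starRingEnd ℂ x) / (R + starRingEnd ℂ x * ζ) ^ 2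

section diskMoebius

variable {R : ℝ} {x : ℂ}

lemma diskMoebius_denom_ne_zero (hx : ‖x‖ < R) {ζ : ℂ} (hζ : ‖ζ‖ ≤ 1) :
    (R : ℂ) + starRingEnd ℂ x * ζ ≠ 0 := by
  intro h0
  have hR : 0 < R := (norm_nonneg x).trans_lt hx
  have h1 : ‖(R : ℂ)‖ = ‖starRingEnd ℂ x * ζ‖ := by
    rw [eq_neg_of_add_eq_zero_left h0, norm_neg]
  rw [norm_mul, RCLike.norm_conj, Complex.norm_real, Real.norm_of_nonneg hR.le] at h1
  nlinarith [norm_nonneg x, norm_nonneg ζ]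

lemma diskMoebius_zero (hx : ‖x‖ < R) : diskMoebius R x 0 = x := by
  have hR : (R : ℂ) ≠ 0 := by exact_mod_cast ((norm_nonneg x).trans_lt hx).ne'
  simp [diskMoebius]
  field_simp

lemma normSq_denom_sub_normSq_num (R : ℝ) (x ζ : ℂ) :
    ‖(R : ℂ) + starRingEnd ℂ x * ζ‖ ^ 2 - ‖R * ζ + x‖ ^ 2 =
      (R ^ 2 - ‖x‖ ^ 2) * (1 - ‖ζ‖ ^ 2) := by
  simp only [← Complex.normSq_eq_norm_sq, Complex.normSq_apply]
  simp
  ring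

lemma norm_diskMoebius_lt (hx : ‖x‖ < R) {ζ : ℂ} (hζ : ‖ζ‖ < 1) :
    ‖diskMoebius R x ζ‖ < R := by
  have hR : 0 < R := (norm_nonneg x).trans_lt hx
  have hd := norm_pos_iff.2 (diskMoebius_denom_ne_zero hx hζ.le)
  rw [diskMoebius, norm_div, norm_mul, Complex.norm_real, Real.norm_of_nonneg hR.le,
    div_lt_iff₀ hd]
  refine mul_lt_mul_of_pos_left ?_ hR
  refine lt_of_pow_lt_pow_left₀ 2 hd.le ?_
  have h1 : 0 < (R ^ 2 - ‖x‖ ^ 2) * (1 - ‖ζ‖ ^ 2) :=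
    mul_pos (by nlinarith [norm_nonneg x]) (by nlinarith [norm_nonneg ζ])
  linarith [normSq_denom_sub_normSq_num R x ζ]

lemma norm_diskMoebius_eq (hx : ‖x‖ < R) {ζ : ℂ} (hζ : ‖ζ‖ = 1) :
    ‖diskMoebius R x ζ‖ = R := by
  have hR : 0 < R := (norm_nonneg x).trans_lt hx
  have hd := norm_pos_iff.2 (diskMoebius_denom_ne_zero hx hζ.le)
  rw [diskMoebius, norm_div, norm_mul, Complex.norm_real, Real.norm_of_nonneg hR.le,
    div_eq_iff hd.ne']
  congr 1
  refine (pow_left_inj₀ (norm_nonneg _) (norm_nonneg _) two_ne_zero).1 ?_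
  have := normSq_denom_sub_normSq_num R x ζ
  rw [hζ] at this
  linarith

lemma hasDerivAt_diskMoebius (hx : ‖x‖ < R) {ζ : ℂ} (hζ : ‖ζ‖ ≤ 1) :
    HasDerivAt (diskMoebius R x) (diskMoebiusDeriv R x ζ) ζ := by
  have hd := diskMoebius_denom_ne_zero hx hζ
  have h1 : HasDerivAt (fun ζ : ℂ => (R : ℂ) * (R * ζ + x)) (R * R) ζ := by
    simpa using (((hasDerivAt_id ζ).const_mul (R : ℂ)).add_const x).const_mul (R : ℂ)
  have h2 : HasDerivAt (fun ζ : ℂ => (R : ℂ) + starRingEnd ℂ x * ζ) (starRingEnd ℂ x) ζ := by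
    simpa using ((hasDerivAt_id ζ).const_mul (starRingEnd ℂ x)).const_add (R : ℂ)
  refine (h1.div h2 hd).congr_deriv ?_
  rw [diskMoebiusDeriv]
  congr 1
  ring

lemma differentiableAt_diskMoebiusDeriv (hx : ‖x‖ < R) {ζ : ℂ} (hζ : ‖ζ‖ ≤ 1) :
    DifferentiableAt ℂ (diskMoebiusDeriv R x) ζ := by
  have hd := diskMoebius_denom_ne_zero hx hζ
  unfold diskMoebiusDeriv
  exact (differentiableAt_const _).div (by fun_prop) (pow_ne_zero 2 hd)

lemma diskMoebius_inverse (hx : ‖x‖ < R) {ζ : ℂ} (hζ : ‖ζ‖ ≤ 1) :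
    ((R : ℂ) ^ 2 - starRingEnd ℂ x * diskMoebius R x ζ) * ζ = R * (diskMoebius R x ζ - x) ∧
      (R : ℂ) ^ 2 - starRingEnd ℂ x * diskMoebius R x ζ ≠ 0 := by
  have hd := diskMoebius_denom_ne_zero hx hζ
  have hR : 0 < R := (norm_nonneg x).trans_lt hx
  constructor
  · rw [diskMoebius]
    field_simp
    ring
  · have e : (R : ℂ) ^ 2 - starRingEnd ℂ x * diskMoebius R x ζ =
        R * (R ^ 2 - x * starRingEnd ℂ x) / (R + starRingEnd ℂ x * ζ) := by
      rw [diskMoebius]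
      field_simp
      ring
    rw [e]
    refine div_ne_zero (mul_ne_zero (by exact_mod_cast hR.ne') ?_) hd
    rw [Complex.mul_conj, Complex.normSq_eq_norm_sq]
    have : R ^ 2 - ‖x‖ ^ 2 ≠ 0 := by nlinarith [norm_nonneg x]
    exact_mod_cast this

lemma diskMoebius_injOn (hx : ‖x‖ < R) : Set.InjOn (diskMoebius R x) (closedBall 0 1) := by
  intro ζ hζ ξ hξ h
  rw [mem_closedBall_zero_iff] at hζ hξ
  obtain ⟨h1, h0⟩ := diskMoebius_inverse hx hζ
  have h2 := (diskMoebius_inverse hx hξ).1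
  rw [← h, ← h1] at h2
  exact (mul_left_cancel₀ h0 h2).symm

/-- `2π` times the Green function of the disk of radius `R`. -/
def diskGreen (R : ℝ) (x y : ℂ) : ℝ :=
  Real.log (‖(R : ℂ) ^ 2 - starRingEnd ℂ x * y‖ / (R * ‖y - x‖))

lemma diskGreen_diskMoebius_exp (hx : ‖x‖ < R) {z : ℂ} (hz : z.re ≤ 0) :
    diskGreen R x (diskMoebius R x (Complex.exp z)) = -z.re := by
  have hR : 0 < R := (norm_nonneg x).trans_lt hx
  have hζ : ‖Complex.exp z‖ ≤ 1 := by rw [Complex.norm_exp]; exact Real.exp_le_one_iff.2 hz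
  obtain ⟨h1, h0⟩ := diskMoebius_inverse hx hζ
  have h2 := congrArg norm h1
  rw [norm_mul, norm_mul, Complex.norm_real, Real.norm_of_nonneg hR.le, Complex.norm_exp] at h2
  rw [diskGreen, ← h2, ← div_div, div_self (norm_ne_zero_iff.2 h0), one_div, Real.log_inv,
    Real.log_exp]

lemma diskMoebius_exp_injOn (hx : ‖x‖ < R) :
    Set.InjOn (fun z => diskMoebius R x (Complex.exp z))
      {z : ℂ | z.re < 0 ∧ z.im ∈ Set.Ioc (-Real.pi) Real.pi} := by
  intro z hz w hw h
  have hb : ∀ z : ℂ, z.re < 0 → Complex.exp z ∈ closedBall (0 : ℂ) 1 := fun z hz => by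
    rw [mem_closedBall_zero_iff, Complex.norm_exp]; exact Real.exp_le_one_iff.2 hz.le
  exact Complex.exp_inj_of_neg_pi_lt_of_le_pi hz.2.1 hz.2.2 hw.2.1 hw.2.2
    (diskMoebius_injOn hx (hb z hz.1) (hb w hw.1) h)

end diskMoebius

lemma abs_det_toSpanSingleton_restrictScalars (q : ℂ) :
    |((ContinuousLinearMap.toSpanSingleton ℂ q).restrictScalars ℝ).det| = ‖q‖ ^ 2 := by
  have h1 : ((ContinuousLinearMap.toSpanSingleton ℂ q).restrictScalars ℝ).det =
      LinearMap.det ((LinearMap.toSpanSingleton ℂ ℂ q).restrictScalars ℝ) := rfl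
  rw [h1, LinearMap.det_restrictScalars, Algebra.norm_complex_eq]
  have : LinearMap.det (LinearMap.toSpanSingleton ℂ ℂ q) = q := by
    simp [LinearMap.det_ring]
  simp [Complex.normSq_eq_norm_sq]

lemma lintegral_strip_le_lintegral_ball {R : ℝ} {x : ℂ} (hx : ‖x‖ < R) (k : ℂ → ℝ) :
    ∫⁻ z in {z : ℂ | z.re < 0 ∧ z.im ∈ Set.Ioc (-Real.pi) Real.pi},
      ENNReal.ofReal (-z.re *
        (‖diskMoebiusDeriv R x (Complex.exp z) * Complex.exp z‖ ^ 2 *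
          |k (diskMoebius R x (Complex.exp z))|)) ≤
    ∫⁻ y in ball (0 : ℂ) R, ENNReal.ofReal (diskGreen R x y * |k y|) := by
  set S := {z : ℂ | z.re < 0 ∧ z.im ∈ Set.Ioc (-Real.pi) Real.pi} with hS
  have hSm : MeasurableSet S :=
    (measurableSet_lt Complex.measurable_re measurable_const).inter
      (Complex.measurable_im measurableSet_Ioc)
  have hb : ∀ z ∈ S, ‖Complex.exp z‖ < 1 := fun z hz => by
    rw [Complex.norm_exp]; exact Real.exp_lt_one_iff.2 hz.1
  have hder : ∀ z ∈ S, HasFDerivWithinAt (fun z => diskMoebius R x (Complex.exp z))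
      ((ContinuousLinearMap.toSpanSingleton ℂ
        (diskMoebiusDeriv R x (Complex.exp z) * Complex.exp z)).restrictScalars ℝ) S z :=
    fun z hz => (((hasDerivAt_diskMoebius hx (hb z hz).le).comp z
      (Complex.hasDerivAt_exp z)).hasFDerivAt.restrictScalars ℝ).hasFDerivWithinAt
  have hcv := lintegral_image_eq_lintegral_abs_det_fderiv_mul volume hSm hder
    (diskMoebius_exp_injOn hx) (fun y => ENNReal.ofReal (diskGreen R x y * |k y|))
  have himg : (fun z => diskMoebius R x (Complex.exp z)) '' S ⊆ ball 0 R := by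
    rintro _ ⟨z, hz, rfl⟩
    rw [mem_ball_zero_iff]
    exact norm_diskMoebius_lt hx (hb z hz)
  refine le_trans (le_of_eq ?_) (lintegral_mono_set himg)
  rw [hcv]
  refine setLIntegral_congr_fun hSm fun z hz => ?_
  rw [abs_det_toSpanSingleton_restrictScalars, ← ENNReal.ofReal_mul (by positivity),
    diskGreen_diskMoebius_exp hx hz.1.le]
  congr 1
  ring

lemma setLIntegral_Icc_prod_le (F : ℂ → ENNReal) {a b : ℝ} (hb : b < 0) :
    ∫⁻ p in Set.Icc (a, -Real.pi) (b, Real.pi), F (p.1 + p.2 * Complex.I) ≤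
      ∫⁻ z in {z : ℂ | z.re < 0 ∧ z.im ∈ Set.Ioc (-Real.pi) Real.pi}, F z := by
  have h1 : (Set.Icc (a, -Real.pi) (b, Real.pi) : Set (ℝ × ℝ)) =ᵐ[volume]
      Set.Icc a b ×ˢ Set.Ioc (-Real.pi) Real.pi := by
    rw [← Set.Icc_prod_Icc]
    exact Measure.set_prod_ae_eq (ae_eq_refl _) Ioc_ae_eq_Icc.symm
  rw [setLIntegral_congr h1]
  have h2 := (Complex.volume_preserving_equiv_real_prod.symm).setLIntegral_comp_preimage_emb
    (Complex.measurableEquivRealProd.symm.measurableEmbedding) F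
    {z : ℂ | z.re < 0 ∧ z.im ∈ Set.Ioc (-Real.pi) Real.pi}
  rw [← h2]
  have h3 : ∀ p : ℝ × ℝ, Complex.measurableEquivRealProd.symm p = p.1 + p.2 * Complex.I :=
    fun p => by
      rw [← Complex.mk_eq_add_mul_I]; rfl
  simp only [h3]
  refine lintegral_mono_set ?_
  rintro p ⟨hp1, hp2⟩
  simp only [Set.mem_preimage, Set.mem_ofPred_eq, h3]
  simpa using ⟨hp1.2.trans_lt hb, hp2⟩

lemma enorm_integral_rectangle_le {R : ℝ} {x : ℂ} (hx : ‖x‖ < R) (k : ℂ → ℝ) {a b : ℝ}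
    (hb : b < 0) :
    ‖∫ p in Set.Icc (a, -Real.pi) (b, Real.pi),
        (b - p.1) * (‖diskMoebiusDeriv R x (Complex.exp (p.1 + p.2 * Complex.I)) *
            Complex.exp (p.1 + p.2 * Complex.I)‖ ^ 2 *
          k (diskMoebius R x (Complex.exp (p.1 + p.2 * Complex.I))))‖ₑ ≤
    ∫⁻ y in ball (0 : ℂ) R, ENNReal.ofReal (diskGreen R x y * |k y|) := by
  refine (enorm_integral_le_lintegral_enorm _).trans ?_
  refine le_trans ?_ ((setLIntegral_Icc_prod_le (fun z => ENNReal.ofReal (-z.re *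
        (‖diskMoebiusDeriv R x (Complex.exp z) * Complex.exp z‖ ^ 2 *
          |k (diskMoebius R x (Complex.exp z))|))) (a := a) hb).trans
    (lintegral_strip_le_lintegral_ball hx k))
  refine setLIntegral_mono' measurableSet_Icc fun p hp => ?_
  rw [← ofReal_norm]
  refine ENNReal.ofReal_le_ofReal ?_
  rw [norm_mul, norm_mul, norm_pow, norm_norm, Real.norm_eq_abs, Real.norm_eq_abs,
    abs_of_nonneg (sub_nonneg.2 hp.2.1)]
  refine mul_le_mul_of_nonneg_right ?_ (by positivity)
  simp
  exact hb.le

/-- Pointwise bound of a `C²` function vanishing on the boundary of a disk by the Green potential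
of the absolute value of its Laplacian. -/
lemma ofReal_two_pi_abs_le_lintegral_diskGreen {R : ℝ} {x : ℂ} (hx : ‖x‖ < R) {h : ℂ → ℝ}
    (hreg : ContDiffOn ℝ 2 h (ball 0 R)) (hcont : ContinuousOn h (closedBall 0 R))
    (hbd : ∀ y ∈ sphere (0 : ℂ) R, h y = 0) :
    ENNReal.ofReal (2 * Real.pi * |h x|) ≤
      ∫⁻ y in ball (0 : ℂ) R, ENNReal.ofReal (diskGreen R x y * |complexLaplacian h y|) := by
  set T := ∫⁻ y in ball (0 : ℂ) R, ENNReal.ofReal (diskGreen R x y * |complexLaplacian h y|)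
    with hT
  by_cases hTtop : T = ⊤
  · rw [hTtop]; exact le_top
  set ψ : ℂ → ℂ := fun z => diskMoebius R x (Complex.exp z) with hψdef
  set q : ℂ → ℂ := fun z => diskMoebiusDeriv R x (Complex.exp z) * Complex.exp z with hqdef
  have hnb : ∀ z : ℂ, z.re < 0 → ‖Complex.exp z‖ < 1 := fun z hz => by
    rw [Complex.norm_exp]; exact Real.exp_lt_one_iff.2 hz
  have hψU : ∀ z : ℂ, z.re < 0 → ψ z ∈ ball (0 : ℂ) R := fun z hz => by
    rw [mem_ball_zero_iff]; exact norm_diskMoebius_lt hx (hnb z hz)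
  have hψ : ∀ z : ℂ, z.re < 0 → HasDerivAt ψ (q z) z := fun z hz =>
    (hasDerivAt_diskMoebius hx (hnb z hz).le).comp z (Complex.hasDerivAt_exp z)
  have hqd : ∀ z : ℂ, z.re < 0 → HasDerivAt q (deriv q z) z := fun z hz =>
    (((differentiableAt_diskMoebiusDeriv hx (hnb z hz).le).comp z
      Complex.differentiableAt_exp).mul Complex.differentiableAt_exp).hasDerivAt
  have hexp : ∀ z : ℂ, Complex.exp (z + 2 * Real.pi * Complex.I) = Complex.exp z := fun z =>
    Complex.exp_periodic z
  have hrect : ∀ a b : ℝ, a ≤ b → b < 0 →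
      |(∫ θ in (-Real.pi)..Real.pi, h (ψ (b + θ * Complex.I))) -
      (∫ θ in (-Real.pi)..Real.pi, ((b - a) * fderiv ℝ h (ψ (a + θ * Complex.I))
        (q (a + θ * Complex.I)) + h (ψ (a + θ * Complex.I))))| ≤ T.toReal := by
    intro a b hab hb
    rw [← integral_rectangle_laplacian_comp isOpen_ball hreg hψU hψ hqd
      (fun z => by simp only [hψdef, hexp]) (fun z => by simp only [hqdef, hexp]) hab hb]
    have := enorm_integral_rectangle_le hx (complexLaplacian h) (a := a) hb
    rw [← ofReal_norm] at this
    exact (ENNReal.ofReal_le_iff_le_toReal hTtop).1 this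
  obtain ⟨C, hC⟩ := (isCompact_closedBall (0 : ℂ) R).exists_bound_of_continuousOn hcont
  have hre : ∀ a θ : ℝ, ((a : ℂ) + θ * Complex.I).re = a := fun a θ => by simp
  have hline : ∀ a : ℝ, Continuous fun θ : ℝ => (a : ℂ) + θ * Complex.I := fun a => by fun_prop
  have hψc : ∀ a : ℝ, a < 0 → Continuous fun θ : ℝ => ψ (a + θ * Complex.I) := fun a ha =>
    continuous_iff_continuousAt.2 fun θ =>
      ((hψ _ (by rwa [hre])).continuousAt).comp (f := fun θ : ℝ => (a : ℂ) + θ * Complex.I)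
        (hline a).continuousAt
  have hqc : ∀ a : ℝ, a < 0 → Continuous fun θ : ℝ => q (a + θ * Complex.I) := fun a ha =>
    continuous_iff_continuousAt.2 fun θ =>
      ((hqd _ (by rwa [hre])).continuousAt).comp (f := fun θ : ℝ => (a : ℂ) + θ * Complex.I)
        (hline a).continuousAt
  have hvc : ∀ a : ℝ, a < 0 → Continuous fun θ : ℝ => h (ψ (a + θ * Complex.I)) := fun a ha =>
    (hcont.mono ball_subset_closedBall).comp_continuous (hψc a ha)
      fun θ => hψU _ (by rwa [hre])
  have hvbound : ∀ a θ : ℝ, a < 0 → ‖h (ψ (a + θ * Complex.I))‖ ≤ C := fun a θ ha =>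
    hC _ (ball_subset_closedBall (hψU _ (by rwa [hre])))
  have hdhc : ContinuousOn (fderiv ℝ h) (ball 0 R) :=
    hreg.continuousOn_fderiv_of_isOpen isOpen_ball (by norm_num)
  -- the inner circles shrink to the point `x`
  have hinner : ∀ b : ℝ, b < 0 →
      Tendsto (fun a : ℝ => ∫ θ in (-Real.pi)..Real.pi,
        ((b - a) * fderiv ℝ h (ψ (a + θ * Complex.I)) (q (a + θ * Complex.I)) +
          h (ψ (a + θ * Complex.I)))) atBot (nhds (∫ _ in (-Real.pi)..Real.pi, h x)) := by
    intro b hb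
    have hE : ∀ θ : ℝ, Tendsto (fun a : ℝ => Complex.exp ((a : ℂ) + θ * Complex.I)) atBot
        (nhds 0) := fun θ => by
      rw [tendsto_zero_iff_norm_tendsto_zero]
      simp only [Complex.norm_exp, hre]
      exact Real.tendsto_exp_atBot
    have hx0 : diskMoebius R x 0 ∈ ball (0 : ℂ) R := by
      rw [diskMoebius_zero hx]; exact mem_ball_zero_iff.2 hx
    have hφ0 : ContinuousAt (diskMoebius R x) 0 :=
      (hasDerivAt_diskMoebius hx (by simp)).continuousAt
    have hM : ContinuousAt (fun ζ => ‖fderiv ℝ h (diskMoebius R x ζ)‖ *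
        ‖diskMoebiusDeriv R x ζ‖) 0 :=
      ((hdhc.continuousAt (isOpen_ball.mem_nhds hx0)).comp hφ0).norm.mul
        (differentiableAt_diskMoebiusDeriv hx (by simp)).continuousAt.norm
    set M := ‖fderiv ℝ h (diskMoebius R x 0)‖ * ‖diskMoebiusDeriv R x 0‖ + 1 with hMdef
    obtain ⟨ε, hε, hMε⟩ := Metric.eventually_nhds_iff.1 (hM.eventually_lt_const (lt_add_one _))
    have hM0 : 0 ≤ M := by positivity
    have hdecay : Tendsto (fun a : ℝ => (b - a) * Real.exp a) atBot (nhds 0) := by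
      have h1 := (Real.tendsto_pow_mul_exp_neg_atTop_nhds_zero 1).comp tendsto_neg_atBot_atTop
      have h2 := (Real.tendsto_exp_atBot.const_mul b).add h1
      simp only [mul_zero, add_zero] at h2
      refine h2.congr fun a => ?_
      simp
      ring
    have hgrad : ∀ᶠ a : ℝ in atBot, ∀ θ : ℝ,
        ‖(b - a) * fderiv ℝ h (ψ (a + θ * Complex.I)) (q (a + θ * Complex.I))‖ ≤
          ((b - a) * Real.exp a) * M := by
      filter_upwards [eventually_le_atBot b, Real.tendsto_exp_atBot.eventually_lt_const hε]
        with a hab ha θ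
      have hn : ‖Complex.exp ((a : ℂ) + θ * Complex.I)‖ = Real.exp a := by
        rw [Complex.norm_exp, hre]
      have h1 := hMε (y := Complex.exp ((a : ℂ) + θ * Complex.I))
        (by rw [dist_zero_right, hn]; exact ha)
      rw [norm_mul, Real.norm_of_nonneg (sub_nonneg.2 hab), mul_assoc]
      refine mul_le_mul_of_nonneg_left ?_ (sub_nonneg.2 hab)
      refine (ContinuousLinearMap.le_opNorm _ _).trans ?_
      simp only [hψdef, hqdef]
      rw [norm_mul, hn, ← mul_assoc, mul_comm]
      exact mul_le_mul_of_nonneg_left h1.le (Real.exp_pos _).le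
    refine intervalIntegral.tendsto_integral_filter_of_dominated_convergence
      (fun _ => M + C) ?_ ?_ intervalIntegrable_const ?_
    · filter_upwards [eventually_lt_atBot 0] with a ha
      have hd : Continuous fun θ : ℝ => fderiv ℝ h (ψ (a + θ * Complex.I)) :=
        hdhc.comp_continuous (hψc a ha) fun θ => hψU _ (by rwa [hre])
      exact ((continuous_const.mul (hd.clm_apply (hqc a ha))).add
        (hvc a ha)).aestronglyMeasurable
    · filter_upwards [hgrad, eventually_lt_atBot 0, hdecay.eventually_lt_const one_pos]
        with a h1 ha h2
      refine ae_of_all _ fun θ _ => (norm_add_le _ _).trans (add_le_add ((h1 θ).trans ?_)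
        (hvbound a θ ha))
      nlinarith
    · refine ae_of_all _ fun θ _ => ?_
      rw [← zero_add (h x)]
      refine Tendsto.add (squeeze_zero_norm' (hgrad.mono fun a h => h θ) ?_) ?_
      · simpa using hdecay.mul_const M
      · have hh0 : ContinuousAt h (diskMoebius R x 0) :=
          (hcont.mono ball_subset_closedBall).continuousAt (isOpen_ball.mem_nhds hx0)
        have := (hh0.comp hφ0).tendsto.comp (hE θ)
        simpa only [Function.comp_def, diskMoebius_zero hx] using this
  have houter : Tendsto (fun b : ℝ => ∫ θ in (-Real.pi)..Real.pi, h (ψ (b + θ * Complex.I)))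
      (nhdsWithin 0 (Set.Iio 0)) (nhds (∫ _ in (-Real.pi)..Real.pi, (0 : ℝ))) := by
    refine intervalIntegral.tendsto_integral_filter_of_dominated_convergence
      (fun _ => C) ?_ ?_ intervalIntegrable_const ?_
    · filter_upwards [self_mem_nhdsWithin] with b hb
      exact (hvc b hb).aestronglyMeasurable
    · filter_upwards [self_mem_nhdsWithin] with b hb
      exact ae_of_all _ fun θ _ => hvbound b θ hb
    · refine ae_of_all _ fun θ _ => ?_
      have hn : ‖Complex.exp (((0 : ℝ) : ℂ) + θ * Complex.I)‖ = 1 := by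
        rw [Complex.norm_exp, hre, Real.exp_zero]
      have hψ0 : ‖ψ (((0 : ℝ) : ℂ) + θ * Complex.I)‖ = R := norm_diskMoebius_eq hx hn
      have hψat : ContinuousAt (fun b : ℝ => ψ ((b : ℂ) + θ * Complex.I)) 0 :=
        (((hasDerivAt_diskMoebius hx hn.le).comp _
          (Complex.hasDerivAt_exp _)).continuousAt).comp
          (f := fun b : ℝ => (b : ℂ) + θ * Complex.I) (by fun_prop)
      have hh0 : h (ψ (((0 : ℝ) : ℂ) + θ * Complex.I)) = 0 :=
        hbd _ (mem_sphere_zero_iff_norm.2 hψ0)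
      have hlim := (hcont _ (mem_closedBall_zero_iff.2 hψ0.le)).tendsto
      rw [hh0] at hlim
      refine hlim.comp ?_
      refine tendsto_nhdsWithin_iff.2 ⟨hψat.tendsto.mono_left nhdsWithin_le_nhds, ?_⟩
      filter_upwards [self_mem_nhdsWithin] with b hb
      exact ball_subset_closedBall (hψU _ (by rwa [hre]))
  have hstep : ∀ b : ℝ, b < 0 → |(∫ θ in (-Real.pi)..Real.pi, h (ψ (b + θ * Complex.I))) -
      ∫ _ in (-Real.pi)..Real.pi, h x| ≤ T.toReal := fun b hb =>
    le_of_tendsto ((tendsto_const_nhds.sub (hinner b hb)).abs)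
      ((eventually_le_atBot b).mono fun a hab => hrect a b hab hb)
  have hfin := le_of_tendsto ((houter.sub_const (∫ _ in (-Real.pi)..Real.pi, h x)).abs)
    (by filter_upwards [self_mem_nhdsWithin] with b hb using hstep b hb)
  refine (ENNReal.ofReal_le_iff_le_toReal hTtop).2 (le_trans (le_of_eq ?_) hfin)
  simp only [intervalIntegral.integral_const, smul_eq_mul, mul_zero, zero_sub, abs_neg, abs_mul]
  rw [abs_of_pos (show 0 < Real.pi - -Real.pi by linarith [Real.pi_pos])]
  ring

lemma center_dist_sq_le {R t a b c d : ℝ} (hDpos : 0 < R^2*t^2-(c^2+d^2)) (ht : 1<t) (hR : 0<R) (hk : c^2+d^2<R^2)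
 (h2 : t^2*(R^2*((c-a)^2+(d-b)^2)) < (R^2-(a*c+b*d))^2+(a*d-b*c)^2) :
 (a - (R ^ 2 * (t ^ 2 - 1) / (R ^ 2 * t ^ 2 - (c^2+d^2)))*c)^2 + (b - (R ^ 2 * (t ^ 2 - 1) / (R ^ 2 * t ^ 2 - (c^2+d^2)))*d)^2 ≤ (R/t)^2 := by
  set D := R^2*t^2-(c^2+d^2) with hD
  have key : (a*D - (R ^ 2 * (t ^ 2 - 1))*c)^2 + (b*D - (R ^ 2 * (t ^ 2 - 1))*d)^2 ≤ (R*t*(R^2-(c^2+d^2)))^2 := by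
    have := mul_lt_mul_of_pos_left h2 hDpos
    have hD' : D = R^2*t^2-(c^2+d^2) := hD
    clear_value D
    subst hD'
    nlinarith
  have k2 : R*t*(R^2-(c^2+d^2)) ≤ R/t * D := by
    rw [hD, div_mul_eq_mul_div, le_div_iff₀ (by linarith)]
    have : (c^2+d^2) ≤ (c^2+d^2)*t^2 := 
      le_mul_of_one_le_right (by positivity) (by nlinarith)
    nlinarith
  have k3 : (R*t*(R^2-(c^2+d^2)))^2 ≤ (R/t * D)^2 :=
    pow_le_pow_left₀ (mul_nonneg (by positivity) (by linarith)) k2 2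
  have e : (a - (R ^ 2 * (t ^ 2 - 1) / D)*c)^2 + (b - (R ^ 2 * (t ^ 2 - 1) / D)*d)^2 = ((a*D - (R ^ 2 * (t ^ 2 - 1))*c)^2 + (b*D - (R ^ 2 * (t ^ 2 - 1))*d)^2)/D^2 := by
    field_simp
  rw [e, div_le_iff₀ (by positivity)]
  linarith [mul_pow (R/t) D 2]

lemma mem_ball_of_lt_quotient {R : ℝ} {x y : ℂ} (hy : ‖y‖ < R) {t : ℝ} (ht : 1 < t)
    (h : t < ‖(R : ℂ) ^ 2 - starRingEnd ℂ x * y‖ / (R * ‖y - x‖)) :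
    x ∈ closedBall (((R ^ 2 * (t ^ 2 - 1) / (R ^ 2 * t ^ 2 - ‖y‖ ^ 2) : ℝ) : ℂ) * y) (R / t) := by
  have hR : 0 < R := (norm_nonneg y).trans_lt hy
  have ht0 : 0 < t := one_pos.trans ht
  have hxy : 0 < R * ‖y - x‖ := by
    rcases (mul_nonneg hR.le (norm_nonneg (y - x))).eq_or_lt with h0 | h0
    · rw [← h0, div_zero] at h; linarith
    · exact h0
  rw [lt_div_iff₀ hxy] at h
  have h2 : t ^ 2 * (R ^ 2 * ‖y - x‖ ^ 2) < ‖(R : ℂ) ^ 2 - starRingEnd ℂ x * y‖ ^ 2 := by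
    calc t ^ 2 * (R ^ 2 * ‖y - x‖ ^ 2) = (t * (R * ‖y - x‖)) ^ 2 := by ring
      _ < _ := pow_lt_pow_left₀ h (by positivity) two_ne_zero
  have hk : ‖y‖ ^ 2 < R ^ 2 := pow_lt_pow_left₀ hy (norm_nonneg y) two_ne_zero
  have ht2 : 1 < t ^ 2 := by nlinarith
  have hDpos : 0 < R ^ 2 * t ^ 2 - ‖y‖ ^ 2 := by nlinarith
  have hy2 : ‖y‖ ^ 2 = y.re ^ 2 + y.im ^ 2 := by
    rw [← Complex.normSq_eq_norm_sq, Complex.normSq_apply]; ring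
  have hyx2 : ‖y - x‖ ^ 2 = (y.re - x.re) ^ 2 + (y.im - x.im) ^ 2 := by
    rw [← Complex.normSq_eq_norm_sq, Complex.normSq_apply, Complex.sub_re, Complex.sub_im]; ring
  have hq2 : ‖(R : ℂ) ^ 2 - starRingEnd ℂ x * y‖ ^ 2 =
      (R ^ 2 - (x.re * y.re + x.im * y.im)) ^ 2 + (x.re * y.im - x.im * y.re) ^ 2 := by
    rw [← Complex.normSq_eq_norm_sq, Complex.normSq_apply]
    simp [pow_two]
    ring
  rw [hyx2, hq2] at h2
  rw [hy2] at hDpos hk ⊢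
  rw [mem_closedBall, dist_eq_norm]
  refine le_of_sq_le_sq ?_ (by positivity)
  refine le_trans (le_of_eq ?_) (center_dist_sq_le hDpos ht hR hk h2)
  rw [← Complex.normSq_eq_norm_sq, Complex.normSq_apply, Complex.sub_re, Complex.sub_im,
    Complex.re_ofReal_mul, Complex.im_ofReal_mul]
  ring

lemma one_le_green_quotient {R : ℝ} {x y : ℂ} (hx : ‖x‖ < R) (hy : ‖y‖ < R) :
    R * ‖y - x‖ ≤ ‖(R : ℂ) ^ 2 - starRingEnd ℂ x * y‖ := by
  have e : ‖(R : ℂ) ^ 2 - starRingEnd ℂ x * y‖ ^ 2 - (R * ‖y - x‖) ^ 2 =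
      (R ^ 2 - ‖x‖ ^ 2) * (R ^ 2 - ‖y‖ ^ 2) := by
    rw [mul_pow]
    simp only [← Complex.normSq_eq_norm_sq, Complex.normSq_apply]
    simp [pow_two]
    ring
  have : 0 ≤ (R ^ 2 - ‖x‖ ^ 2) * (R ^ 2 - ‖y‖ ^ 2) :=
    mul_nonneg (by nlinarith [norm_nonneg x]) (by nlinarith [norm_nonneg y])
  exact le_of_sq_le_sq (by linarith) (norm_nonneg _)

lemma diskGreen_nonneg {R : ℝ} {x y : ℂ} (hx : ‖x‖ < R) (hy : ‖y‖ < R) :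
    0 ≤ diskGreen R x y := by
  have hR : 0 < R := (norm_nonneg y).trans_lt hy
  rcases eq_or_ne y x with rfl | hne
  · simp [diskGreen]
  · have : 0 < ‖y - x‖ := norm_pos_iff.2 (sub_ne_zero.2 hne)
    exact Real.log_nonneg ((one_le_div₀ (by positivity)).2 (one_le_green_quotient hx hy))

lemma measurable_diskGreen (R : ℝ) : Measurable (Function.uncurry (diskGreen R)) := by
  unfold diskGreen Function.uncurry
  have : Measurable (starRingEnd ℂ) := Complex.continuous_conj.measurable
  fun_prop

/-- The superlevel sets of `exp (diskGreen R · y)` are no larger than those for `y = 0`, which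
bounds the integrals of its powers. -/
lemma lintegral_exp_diskGreen_le {R : ℝ} {y : ℂ} (hy : ‖y‖ < R) {α : ℝ} (hα0 : 0 < α)
    (hα2 : α < 2) :
    ∫⁻ x in ball (0 : ℂ) R, ENNReal.ofReal (Real.exp (α * diskGreen R x y)) ≤
      ENNReal.ofReal (2 * Real.pi * R ^ 2 / (2 - α)) := by
  have hR : 0 < R := (norm_nonneg y).trans_lt hy
  set g : ℂ → ℝ := fun x => ‖(R : ℂ) ^ 2 - starRingEnd ℂ x * y‖ / (R * ‖y - x‖) with hg
  have hgm : Measurable g := by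
    have : Measurable (starRingEnd ℂ) := Complex.continuous_conj.measurable
    simp only [hg]
    fun_prop
  have hvol : ∀ (c : ℂ) (r : ℝ), 0 ≤ r →
      volume (closedBall c r) = ENNReal.ofReal (Real.pi * r ^ 2) := by
    intro c r hr
    rw [Complex.volume_closedBall, ENNReal.ofReal_mul Real.pi_pos.le, ENNReal.ofReal_pow hr,
      mul_comm]
    congr 1
    exact (ENNReal.ofReal_coe_nnreal (p := NNReal.pi)).symm
  have h1 : ∫⁻ x in ball (0 : ℂ) R, ENNReal.ofReal (Real.exp (α * diskGreen R x y)) =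
      ∫⁻ x in ball (0 : ℂ) R, ENNReal.ofReal (g x ^ α) := by
    refine lintegral_congr_ae ?_
    have hne : ∀ᵐ x : ℂ ∂(volume.restrict (ball 0 R)), x ≠ y :=
      ae_restrict_of_ae (Measure.ae_ne volume y)
    filter_upwards [hne, ae_restrict_mem measurableSet_ball] with x hxy hx
    have hx' := mem_ball_zero_iff.1 hx
    have : 0 < ‖y - x‖ := norm_pos_iff.2 (sub_ne_zero.2 hxy.symm)
    have hpos : 0 < g x :=
      div_pos ((by positivity : 0 < R * ‖y - x‖).trans_le (one_le_green_quotient hx' hy))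
        (by positivity)
    rw [Real.rpow_def_of_pos hpos, mul_comm]
    rfl
  rw [h1, lintegral_rpow_eq_lintegral_meas_lt_mul _ (ae_of_all _ fun x => by positivity)
    hgm.aemeasurable hα0]
  have hm1 : ∀ t : ℝ, (volume.restrict (ball (0 : ℂ) R)) {a | t < g a} ≤
      ENNReal.ofReal (Real.pi * R ^ 2) := fun t => by
    rw [← hvol 0 R hR.le]
    exact (measure_mono (Set.subset_univ _)).trans
      ((Measure.restrict_apply_univ _).trans_le (measure_mono ball_subset_closedBall))
  have hm2 : ∀ t : ℝ, 1 < t → (volume.restrict (ball (0 : ℂ) R)) {a | t < g a} ≤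
      ENNReal.ofReal (Real.pi * (R / t) ^ 2) := fun t ht => by
    rw [← hvol _ (R / t) (by positivity)]
    exact (Measure.restrict_apply_le _ _).trans
      (measure_mono fun x hx => mem_ball_of_lt_quotient hy ht hx)
  rw [← Set.Ioc_union_Ioi_eq_Ioi (zero_le_one' ℝ)]
  have hI1 : ∫⁻ t in Set.Ioc (0 : ℝ) 1, (volume.restrict (ball (0 : ℂ) R)) {a | t < g a} *
      ENNReal.ofReal (t ^ (α - 1)) ≤ ENNReal.ofReal (Real.pi * R ^ 2 / α) := by
    have hint : IntegrableOn (fun t : ℝ => Real.pi * R ^ 2 * t ^ (α - 1)) (Set.Ioc 0 1) :=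
      (((intervalIntegral.intervalIntegrable_rpow' (by linarith)).1).const_mul _)
    have hval : ∫ t in Set.Ioc (0 : ℝ) 1, Real.pi * R ^ 2 * t ^ (α - 1) =
        Real.pi * R ^ 2 / α := by
      rw [← intervalIntegral.integral_of_le zero_le_one, intervalIntegral.integral_const_mul,
        integral_rpow (Or.inl (by linarith))]
      simp [hα0.ne']
      ring
    rw [← hval, ofReal_integral_eq_lintegral_ofReal hint
      ((ae_restrict_mem measurableSet_Ioc).mono fun t ht => by
        have := ht.1
        positivity)]
    refine setLIntegral_mono' measurableSet_Ioc fun t ht => ?_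
    rw [ENNReal.ofReal_mul (by positivity)]
    gcongr
    exact hm1 t
  have hI2 : ∫⁻ t in Set.Ioi (1 : ℝ), (volume.restrict (ball (0 : ℂ) R)) {a | t < g a} *
      ENNReal.ofReal (t ^ (α - 1)) ≤ ENNReal.ofReal (Real.pi * R ^ 2 / (2 - α)) := by
    have hint : IntegrableOn (fun t : ℝ => Real.pi * R ^ 2 * t ^ (α - 3)) (Set.Ioi 1) :=
      (integrableOn_Ioi_rpow_of_lt (by linarith) one_pos).const_mul _
    have hval : ∫ t in Set.Ioi (1 : ℝ), Real.pi * R ^ 2 * t ^ (α - 3) =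
        Real.pi * R ^ 2 / (2 - α) := by
      rw [integral_const_mul, integral_Ioi_rpow_of_lt (by linarith) one_pos, Real.one_rpow,
        show α - 3 + 1 = -(2 - α) by ring, neg_div_neg_eq]
      ring
    rw [← hval, ofReal_integral_eq_lintegral_ofReal hint
      ((ae_restrict_mem measurableSet_Ioi).mono fun t ht => by
        have : (0 : ℝ) < t := one_pos.trans ht
        positivity)]
    refine setLIntegral_mono' measurableSet_Ioi fun t ht => ?_
    have ht0 : (0 : ℝ) < t := one_pos.trans ht
    refine (mul_le_mul_left (hm2 t ht) _).trans (le_of_eq ?_)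
    rw [← ENNReal.ofReal_mul (by positivity)]
    congr 1
    rw [show α - 1 = (α - 3) + 2 by ring, Real.rpow_add ht0, Real.rpow_two]
    field_simp
  have h2α : 0 < 2 - α := by linarith
  calc _ ≤ ENNReal.ofReal α * (ENNReal.ofReal (Real.pi * R ^ 2 / α) +
        ENNReal.ofReal (Real.pi * R ^ 2 / (2 - α))) := by
        gcongr
        exact (lintegral_union_le _ _ _).trans (add_le_add hI1 hI2)
    _ = ENNReal.ofReal (2 * Real.pi * R ^ 2 / (2 - α)) := by
        rw [← ENNReal.ofReal_add (by positivity) (by positivity), ← ENNReal.ofReal_mul hα0.le]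
        congr 1
        field_simp
        ring

/-- A form of Jensen's inequality for the exponential which does not presuppose integrability. -/
lemma ofReal_exp_le_lintegral_exp_mul {Ω : Type*} [MeasurableSpace Ω] {μ : Measure Ω}
    {ρ u : Ω → ℝ} (hρ : Integrable ρ μ) (hρ0 : ∀ y, 0 ≤ ρ y) (hρ1 : ∫ y, ρ y ∂μ = 1)
    (hu : AEStronglyMeasurable u μ) (hu0 : ∀ᵐ y ∂μ, 0 ≤ u y) {s : ℝ}
    (hs : ENNReal.ofReal s ≤ ∫⁻ y, ENNReal.ofReal (u y * ρ y) ∂μ) :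
    ENNReal.ofReal (Real.exp s) ≤ ∫⁻ y, ENNReal.ofReal (Real.exp (u y) * ρ y) ∂μ := by
  by_cases htop : ∫⁻ y, ENNReal.ofReal (Real.exp (u y) * ρ y) ∂μ = ⊤
  · rw [htop]; exact le_top
  have hem : AEStronglyMeasurable (fun y => Real.exp (u y) * ρ y) μ :=
    (Real.continuous_exp.comp_aestronglyMeasurable hu).mul hρ.aestronglyMeasurable
  have he0 : ∀ y, 0 ≤ Real.exp (u y) * ρ y := fun y => mul_nonneg (Real.exp_pos _).le (hρ0 y)
  have hei : Integrable (fun y => Real.exp (u y) * ρ y) μ :=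
    (lintegral_ofReal_ne_top_iff_integrable hem (ae_of_all _ he0)).1 htop
  have hui : Integrable (fun y => u y * ρ y) μ := by
    refine hei.mono' (hu.mul hρ.aestronglyMeasurable) ?_
    filter_upwards [hu0] with y hy
    rw [Real.norm_of_nonneg (mul_nonneg hy (hρ0 y))]
    exact mul_le_mul_of_nonneg_right (by linarith [Real.add_one_le_exp (u y)]) (hρ0 y)
  have hu0' : 0 ≤ᵐ[μ] fun y => u y * ρ y := hu0.mono fun y hy => mul_nonneg hy (hρ0 y)
  rw [← ofReal_integral_eq_lintegral_ofReal hui hu0',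
    ENNReal.ofReal_le_ofReal_iff (integral_nonneg_of_ae hu0')] at hs
  rw [← ofReal_integral_eq_lintegral_ofReal hei (ae_of_all _ he0)]
  refine ENNReal.ofReal_le_ofReal ?_
  set m := ∫ y, u y * ρ y ∂μ with hm
  have hlin : ∫ y, Real.exp m * ((1 - m) * ρ y + u y * ρ y) ∂μ = Real.exp m := by
    rw [integral_const_mul, integral_add (hρ.const_mul _) hui, integral_const_mul, hρ1, ← hm]
    ring
  calc Real.exp s ≤ Real.exp m := Real.exp_le_exp.2 hs
    _ = ∫ y, Real.exp m * ((1 - m) * ρ y + u y * ρ y) ∂μ := hlin.symm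
    _ ≤ _ := by
      refine integral_mono (((hρ.const_mul _).add hui).const_mul _) hei fun y => ?_
      have h1 : Real.exp m * (1 + (u y - m)) ≤ Real.exp (u y) := by
        have := mul_le_mul_of_nonneg_left (Real.add_one_le_exp (u y - m)) (Real.exp_pos m).le
        rw [← Real.exp_add] at this
        ring_nf at this ⊢
        exact this
      have := mul_le_mul_of_nonneg_right h1 (hρ0 y)
      linarith

/-- The Brezis–Merle inequality on a disk in the complex plane, in `lintegral` form. -/
lemma lintegral_exp_abs_le {R : ℝ} {h : ℂ → ℝ}
    (hreg : ContDiffOn ℝ 2 h (ball 0 R)) (hcont : ContinuousOn h (closedBall 0 R))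
    (hbd : ∀ y ∈ sphere (0 : ℂ) R, h y = 0)
    (hint : IntegrableOn (fun y => |complexLaplacian h y|) (ball 0 R))
    (hpos : 0 < ∫ y in ball (0 : ℂ) R, |complexLaplacian h y|)
    {δ : ℝ} (hδ0 : 0 < δ) (hδ : δ < 4 * Real.pi) :
    ∫⁻ x in ball (0 : ℂ) R, ENNReal.ofReal (Real.exp ((4 * Real.pi - δ) * |h x| /
      ∫ y in ball (0 : ℂ) R, |complexLaplacian h y|)) ≤
      ENNReal.ofReal (4 * Real.pi ^ 2 / δ * R ^ 2) := by
  set μ := volume.restrict (ball (0 : ℂ) R) with hμ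
  set F := ∫ y in ball (0 : ℂ) R, |complexLaplacian h y| with hF
  have hπ := Real.pi_pos
  set α := (4 * Real.pi - δ) / (2 * Real.pi) with hα
  have hα0 : 0 < α := div_pos (by linarith) (by linarith)
  have hα2 : α < 2 := by rw [hα, div_lt_iff₀ (by linarith)]; linarith
  set ρ : ℂ → ℝ := fun y => |complexLaplacian h y| / F with hρdef
  have hρ : Integrable ρ μ := hint.div_const F
  have hρ0 : ∀ y, 0 ≤ ρ y := fun y => div_nonneg (abs_nonneg _) hpos.le
  have hρ1 : ∫ y, ρ y ∂μ = 1 := by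
    rw [integral_div, ← hF, div_self hpos.ne']
  have hLm : Measurable fun p : ℂ × ℂ => α * diskGreen R p.1 p.2 :=
    (measurable_diskGreen R).const_mul α
  have hpoint : ∀ x ∈ ball (0 : ℂ) R,
      ENNReal.ofReal (Real.exp ((4 * Real.pi - δ) * |h x| / F)) ≤
        ∫⁻ y, ENNReal.ofReal (Real.exp (α * diskGreen R x y) * ρ y) ∂μ := by
    intro x hx
    have hx' := mem_ball_zero_iff.1 hx
    refine ofReal_exp_le_lintegral_exp_mul hρ hρ0 hρ1
      (hLm.comp measurable_prodMk_left).aestronglyMeasurable ?_ ?_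
    · filter_upwards [ae_restrict_mem measurableSet_ball] with y hy
      exact mul_nonneg hα0.le (diskGreen_nonneg hx' (mem_ball_zero_iff.1 hy))
    · have hαF : 0 ≤ α / F := by positivity
      have e1 : (4 * Real.pi - δ) * |h x| / F = α / F * (2 * Real.pi * |h x|) := by
        rw [hα]; field_simp
      have e2 : ∀ y, ENNReal.ofReal (α * diskGreen R x y * ρ y) =
          ENNReal.ofReal (α / F) *
            ENNReal.ofReal (diskGreen R x y * |complexLaplacian h y|) := fun y => by
        rw [← ENNReal.ofReal_mul hαF, hρdef]
        congr 1
        ring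
      refine le_of_le_of_eq ?_ (lintegral_congr e2).symm
      rw [e1, ENNReal.ofReal_mul hαF, lintegral_const_mul' _ _ ENNReal.ofReal_ne_top]
      gcongr
      exact ofReal_two_pi_abs_le_lintegral_diskGreen hx' hreg hcont hbd
  calc _ ≤ ∫⁻ x, ∫⁻ y, ENNReal.ofReal (Real.exp (α * diskGreen R x y) * ρ y) ∂μ ∂μ :=
        setLIntegral_mono' measurableSet_ball hpoint
    _ = ∫⁻ y, ∫⁻ x, ENNReal.ofReal (Real.exp (α * diskGreen R x y) * ρ y) ∂μ ∂μ := by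
        refine lintegral_lintegral_swap ?_
        exact ((Real.measurable_exp.comp hLm).aemeasurable.mul
          hρ.aestronglyMeasurable.aemeasurable.comp_snd).ennreal_ofReal
    _ ≤ ∫⁻ y, ENNReal.ofReal (4 * Real.pi ^ 2 / δ * R ^ 2) * ENNReal.ofReal (ρ y) ∂μ := by
        refine setLIntegral_mono' measurableSet_ball fun y hy => ?_
        simp only [ENNReal.ofReal_mul (Real.exp_pos _).le]
        rw [lintegral_mul_const' _ _ ENNReal.ofReal_ne_top]
        gcongr
        refine (lintegral_exp_diskGreen_le (mem_ball_zero_iff.1 hy) hα0 hα2).trans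
          (le_of_eq ?_)
        have : 2 - α = δ / (2 * Real.pi) := by rw [hα]; field_simp; ring
        rw [this]
        congr 1
        field_simp
        ring
    _ = _ := by
        rw [lintegral_const_mul' _ _ ENNReal.ofReal_ne_top,
          ← ofReal_integral_eq_lintegral_ofReal hρ (ae_of_all _ hρ0), hρ1]
        simp

lemma complexLaplacian_comp_repr {U : Set (EuclideanSpace ℝ (Fin 2))} (hU : IsOpen U)
    {h : EuclideanSpace ℝ (Fin 2) → ℝ} (hreg : ContDiffOn ℝ 2 h U) {z : ℂ}
    (hz : Complex.orthonormalBasisOneI.repr z ∈ U) :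
    complexLaplacian (fun w => h (Complex.orthonormalBasisOneI.repr w)) z =
      lap2 h (Complex.orthonormalBasisOneI.repr z) := by
  set e : ℂ ≃L[ℝ] EuclideanSpace ℝ (Fin 2) :=
    Complex.orthonormalBasisOneI.repr.toContinuousLinearEquiv with he
  change e z ∈ U at hz
  change complexLaplacian (fun w => h (e w)) z = lap2 h (e z)
  have he1 : e 1 = EuclideanSpace.single 0 1 := by
    have := Complex.orthonormalBasisOneI.repr_self 0
    simp only [Complex.coe_orthonormalBasisOneI] at this
    exact this
  have he2 : e Complex.I = EuclideanSpace.single 1 1 := by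
    have := Complex.orthonormalBasisOneI.repr_self 1
    simp only [Complex.coe_orthonormalBasisOneI] at this
    exact this
  have hd : DifferentiableAt ℝ (fderiv ℝ h) (e z) :=
    ((hreg.fderiv_of_isOpen hU (m := 1) (by norm_num)).differentiableOn
      (by norm_num)).differentiableAt (hU.mem_nhds hz)
  have h1 : fderiv ℝ (fun w => h (e w)) = fun w => (fderiv ℝ h (e w)).comp (e : ℂ →L[ℝ] _) :=
    funext fun w => e.comp_right_fderiv (f := h)
  have h2 : ∀ u : ℂ, fderiv ℝ (fderiv ℝ (fun w => h (e w))) z u u =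
      fderiv ℝ (fderiv ℝ h) (e z) (e u) (e u) := fun u => by
    have := (hd.hasFDerivAt.comp z e.hasFDerivAt).clm_comp
      (hasFDerivAt_const (e : ℂ →L[ℝ] EuclideanSpace ℝ (Fin 2)) z)
    simp only [Function.comp_def] at this
    rw [h1, this.fderiv]
    simp
  have h3 : ∀ v, fderiv ℝ (fun y => fderiv ℝ h y v) (e z) v =
      fderiv ℝ (fderiv ℝ h) (e z) v v := fun v => by
    rw [(hd.hasFDerivAt.clm_apply (hasFDerivAt_const v (e z))).fderiv]
    simp
  simp only [complexLaplacian, lap2, h2, h3, Fin.sum_univ_two, he1, he2]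

lemma setIntegral_ball_comp_repr (g : EuclideanSpace ℝ (Fin 2) → ℝ) (R : ℝ) :
    ∫ z in ball (0 : ℂ) R, g (Complex.orthonormalBasisOneI.repr z) =
      ∫ x in ball (0 : EuclideanSpace ℝ (Fin 2)) R, g x := by
  rw [← Complex.orthonormalBasisOneI.measurePreserving_repr.setIntegral_preimage_emb
    Complex.orthonormalBasisOneI.repr.toHomeomorph.measurableEmbedding]
  simp

/-- Brezis–Merle inequality on the disk `B_R ⊂ ℝ²`. -/
theorem brezis_merle (R : ℝ) (hR : 0 < R)
    (f h : EuclideanSpace ℝ (Fin 2) → ℝ)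
    (hf : IntegrableOn f (Metric.ball (0 : EuclideanSpace ℝ (Fin 2)) R))
    (hfpos : 0 < ∫ x in Metric.ball (0 : EuclideanSpace ℝ (Fin 2)) R, |f x|)
    (hreg : ContDiffOn ℝ 2 h (Metric.ball (0 : EuclideanSpace ℝ (Fin 2)) R))
    (hcont : ContinuousOn h (Metric.closedBall (0 : EuclideanSpace ℝ (Fin 2)) R))
    (heq : ∀ x ∈ Metric.ball (0 : EuclideanSpace ℝ (Fin 2)) R, -lap2 h x = f x)
    (hbd : ∀ x ∈ Metric.sphere (0 : EuclideanSpace ℝ (Fin 2)) R, h x = 0)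
    (δ : ℝ) (hδ0 : 0 < δ) (hδ4π : δ < 4 * Real.pi) :
    (∫ x in Metric.ball (0 : EuclideanSpace ℝ (Fin 2)) R,
        Real.exp ((4 * Real.pi - δ) * |h x| /
          ∫ x in Metric.ball (0 : EuclideanSpace ℝ (Fin 2)) R, |f x|)) ≤
      4 * Real.pi ^ 2 / δ * R ^ 2 := by
  set e := Complex.orthonormalBasisOneI.repr with he
  set H : ℂ → ℝ := fun z => h (e z) with hH
  have hball : ∀ z ∈ ball (0 : ℂ) R, e z ∈ ball (0 : EuclideanSpace ℝ (Fin 2)) R := fun z hz => by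
    simpa using hz
  have hlap : ∀ z ∈ ball (0 : ℂ) R, |complexLaplacian H z| = |f (e z)| := fun z hz => by
    rw [hH, complexLaplacian_comp_repr isOpen_ball hreg (hball z hz), ← heq _ (hball z hz), abs_neg]
  have hF : ∫ z in ball (0 : ℂ) R, |complexLaplacian H z| =
      ∫ x in ball (0 : EuclideanSpace ℝ (Fin 2)) R, |f x| := by
    rw [setIntegral_congr_fun measurableSet_ball hlap]
    exact setIntegral_ball_comp_repr (fun x => |f x|) R
  have hregH : ContDiffOn ℝ 2 H (ball 0 R) :=
    hreg.comp e.toContinuousLinearEquiv.contDiff.contDiffOn hball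
  have hcontH : ContinuousOn H (closedBall 0 R) :=
    hcont.comp e.continuous.continuousOn fun z hz => by simpa using hz
  have hbdH : ∀ z ∈ sphere (0 : ℂ) R, H z = 0 := fun z hz => hbd _ (by simpa using hz)
  have hint : IntegrableOn (fun z => |complexLaplacian H z|) (ball 0 R) :=
    Integrable.of_integral_ne_zero (by rw [hF]; exact hfpos.ne')
  have main := lintegral_exp_abs_le hregH hcontH hbdH hint (by rwa [hF]) hδ0 hδ4π
  rw [hF] at main
  rw [← setIntegral_ball_comp_repr (fun x => Real.exp ((4 * Real.pi - δ) * |h x| /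
    ∫ x in ball (0 : EuclideanSpace ℝ (Fin 2)) R, |f x|))]
  refine (Real.le_norm_self _).trans ((norm_integral_le_lintegral_norm _).trans ?_)
  refine ENNReal.toReal_le_of_le_ofReal (by positivity) ?_
  simpa only [Real.norm_eq_abs, Real.abs_exp] using main
end
end

section
/- Let n ≥ 2 and 0 < μ < n. Suppose u : ℝⁿ → ℝ is continuous and satisfies condition (B). Then J(x) ≥ −α ln|x| for every x ∈ ℝⁿ with |x| ≥ 2. -/
open MeasureTheory Real Filter Metric

noncomputable section

/-- `J(x) = (1/βₙ) ∫ ln((|y|+1)/|x-y|) v(y) e^{((2n-μ)/2) u(y)} dy`. -/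
noncomputable def Jfun (n : ℕ) (μ : ℝ) (u : EuclideanSpace ℝ (Fin n) → ℝ)
    (x : EuclideanSpace ℝ (Fin n)) : ℝ :=
  (1 / betaN n) *
    ∫ y, Real.log ((‖y‖ + 1) / ‖x - y‖) * (V n μ u y * Real.exp ((2 * n - μ) / 2 * u y))

lemma V_nonneg (n : ℕ) (μ : ℝ) (u : EuclideanSpace ℝ (Fin n) → ℝ)
    (x : EuclideanSpace ℝ (Fin n)) : 0 ≤ V n μ u x :=
  integral_nonneg fun _ => by positivity

lemma betaN_nonneg (n : ℕ) : 0 ≤ betaN n := by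
  have h : 0 ≤ Real.Gamma ((n : ℝ) / 2) := Real.Gamma_nonneg_of_nonneg (by positivity)
  have h' : 0 ≤ Real.Gamma ((n : ℝ) / 2 + 1) := Real.Gamma_nonneg_of_nonneg (by positivity)
  unfold betaN
  positivity

/-- Under condition (B), the density `v e^{((2n-μ)/2) u}` is integrable. -/
lemma CondB.integrable_V_mul_exp {n : ℕ} {μ : ℝ} {u : EuclideanSpace ℝ (Fin n) → ℝ}
    (hB : CondB n μ u) :
    Integrable fun y => V n μ u y * Real.exp ((2 * n - μ) / 2 * u y) := by
  refine (Integrable.integral_prod_left hB.2).congr (Eventually.of_forall fun y => ?_)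
  simp only [V, mul_div_assoc]
  rw [integral_const_mul, mul_comm]

lemma neg_log_norm_le_log_div {E : Type*} [NormedAddCommGroup E] {x : E} (hx : 1 ≤ ‖x‖) (y : E) :
    -Real.log ‖x‖ ≤ Real.log ((‖y‖ + 1) / ‖x - y‖) := by
  rcases eq_or_ne x y with rfl | hxy
  · simpa using Real.log_nonneg hx
  have hpos : 0 < ‖x - y‖ := norm_pos_iff.2 (sub_ne_zero.2 hxy)
  have hx0 : 0 < ‖x‖ := one_pos.trans_le hx
  rw [← Real.log_inv]
  refine Real.log_le_log (inv_pos.2 hx0) ?_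
  rw [inv_eq_one_div, div_le_div_iff₀ hx0 hpos]
  nlinarith [norm_sub_le x y, norm_nonneg y]

theorem Jfun_lower_bound (n : ℕ) (hn : 2 ≤ n) (μ : ℝ) (hμ0 : 0 < μ) (hμn : μ < n)
    (u : EuclideanSpace ℝ (Fin n) → ℝ) (hu : Continuous u) (hB : CondB n μ u) :
    ∀ x : EuclideanSpace ℝ (Fin n), 2 ≤ ‖x‖ →
      Jfun n μ u x ≥ -(alphaC n μ u) * Real.log ‖x‖ := by
  intro x hx
  have hx1 : 1 ≤ ‖x‖ := one_le_two.trans hx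
  have hw (y) : 0 ≤ V n μ u y * Real.exp ((2 * n - μ) / 2 * u y) :=
    mul_nonneg (V_nonneg n μ u y) (Real.exp_nonneg _)
  suffices h : -Real.log ‖x‖ * ∫ y, V n μ u y * Real.exp ((2 * n - μ) / 2 * u y) ≤
      ∫ y, Real.log ((‖y‖ + 1) / ‖x - y‖) * (V n μ u y * Real.exp ((2 * n - μ) / 2 * u y)) by
    have := mul_le_mul_of_nonneg_left h (one_div_nonneg.2 (betaN_nonneg n))
    unfold Jfun alphaC
    linarith
  by_cases hint : Integrable fun y => Real.log ((‖y‖ + 1) / ‖x - y‖) *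
      (V n μ u y * Real.exp ((2 * n - μ) / 2 * u y))
  · rw [← integral_const_mul]
    exact integral_mono (hB.integrable_V_mul_exp.const_mul _) hint fun y =>
      mul_le_mul_of_nonneg_right (neg_log_norm_le_log_div hx1 y) (hw y)
  · -- The Bochner integral of a non-integrable function is `0`.
    rw [integral_undef hint]
    exact mul_nonpos_of_nonpos_of_nonneg (neg_nonpos.2 (Real.log_nonneg hx1)) (integral_nonneg hw)
end
end

section
/- Let n ≥ 2 and 0 < μ < n. Suppose u ∈ Cⁿ(ℝⁿ) satisfies condition (B) and the integral equation (IE). Then there exist constants C > 0 and R > 0 such that |x| |∇u(x)| ≤ C and |x| |∇v(x)| ≤ C for all x ∈ ℝⁿ with |x| ≥ R. -/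
open MeasureTheory Real Filter Metric

noncomputable section

section Kernel

theorem exp_integral_mul_le {X : Type*} [MeasureSpace X] {φ h : X → ℝ} (h0 : ∀ y, 0 ≤ φ y)
    (hφ : Integrable φ) (hφ1 : ∫ y, φ y ≤ 1) (hφh : Integrable fun y => φ y * h y)
    (hφe : Integrable fun y => φ y * exp (h y)) :
    exp (∫ y, φ y * h y) ≤ 1 + ∫ y, φ y * exp (h y) := by
  set I := ∫ y, φ y * h y with hI
  have hle : ∀ y, φ y * (exp I * (1 - I)) + exp I * (φ y * h y) ≤ φ y * exp (h y) := by
    intro y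
    have h1 : h y - I + 1 ≤ exp (h y - I) := Real.add_one_le_exp _
    have h2 : exp (h y) = exp I * exp (h y - I) := by rw [← Real.exp_add]; congr 1; ring
    have h3 := mul_le_mul_of_nonneg_left
      (mul_le_mul_of_nonneg_left h1 (Real.exp_pos I).le) (h0 y)
    rw [h2]
    linarith
  have hm := integral_mono ((hφ.mul_const _).add (hφh.const_mul _)) hφe hle
  simp only [Pi.add_apply] at hm
  rw [integral_add (hφ.mul_const _) (hφh.const_mul _), integral_mul_const,
    integral_const_mul, ← hI] at hm
  have h4 : exp I * (1 - I) ≤ 1 := by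
    have h5 : -I + 1 ≤ exp (-I) := Real.add_one_le_exp _
    have h6 := mul_le_mul_of_nonneg_left h5 (Real.exp_pos I).le
    rw [← Real.exp_add, add_neg_cancel, Real.exp_zero] at h6
    linarith
  have h7 := mul_le_mul_of_nonneg_left h4 (sub_nonneg.2 hφ1)
  have h8 : 0 ≤ ∫ y, φ y := integral_nonneg h0
  linarith

/-- The integral of `‖t‖ ^ (-a)` over the unit ball of `E`. -/
def kernelMass (E : Type*) [NormedAddCommGroup E] [NormedSpace ℝ E] [MeasureSpace E] (a : ℝ) : ℝ :=
  ∫ t in ball (0 : E) 1, ‖t‖ ^ (-a)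

theorem kernelMass_nonneg {E : Type*} [NormedAddCommGroup E] [NormedSpace ℝ E] [MeasureSpace E]
    (a : ℝ) : 0 ≤ kernelMass E a :=
  integral_nonneg fun _ => by positivity

variable {E : Type*} [NormedAddCommGroup E] [NormedSpace ℝ E] [FiniteDimensional ℝ E]
  [MeasureSpace E] [BorelSpace E] [(volume : Measure E).IsAddHaarMeasure]

open scoped Pointwise in
theorem setIntegral_ball_norm_rpow_neg {a r : ℝ} (hr : 0 < r) :
    ∫ t in ball (0 : E) r, ‖t‖ ^ (-a) = kernelMass E a * r ^ (Module.finrank ℝ E - a) := by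
  have h := Measure.setIntegral_comp_smul_of_pos (volume : Measure E)
    (fun t : E => ‖t‖ ^ (-a)) (ball (0 : E) 1) hr
  have hb : r • ball (0 : E) 1 = ball 0 r := by
    rw [_root_.smul_ball hr.ne', smul_zero, Real.norm_of_nonneg hr.le, mul_one]
  rw [hb] at h
  have h2 : ∫ t in ball (0 : E) 1, ‖r • t‖ ^ (-a) = r ^ (-a) * kernelMass E a := by
    rw [kernelMass, ← integral_const_mul]
    refine integral_congr_ae (ae_of_all _ fun t => ?_)
    simp only [norm_smul, Real.norm_of_nonneg hr.le]
    exact Real.mul_rpow hr.le (norm_nonneg _)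
  rw [h2, smul_eq_mul, ← Real.rpow_natCast] at h
  rw [sub_eq_add_neg, Real.rpow_add hr]
  have hp : 0 < r ^ (Module.finrank ℝ E : ℝ) := by positivity
  field_simp at h
  linarith

variable [Nontrivial E]

theorem integrableOn_ball_norm_rpow_neg {a r : ℝ} (ha : a < Module.finrank ℝ E) (hr : 0 < r) :
    IntegrableOn (fun t : E => ‖t‖ ^ (-a)) (ball 0 r) := by
  rw [integrableOn_fun_norm_addHaar volume (f := fun y => y ^ (-a))]
  have hd : 1 ≤ Module.finrank ℝ E := Module.finrank_pos
  have h := (intervalIntegral.integrableOn_Ioo_rpow_iff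
    (s := (Module.finrank ℝ E : ℝ) - 1 - a) hr).2 (by linarith)
  refine h.congr_fun (fun y hy => ?_) measurableSet_Ioo
  simp only [smul_eq_mul]
  rw [← Real.rpow_natCast, ← Real.rpow_add hy.1, Nat.cast_sub hd]
  congr 1
  push_cast
  ring

/-- A nonnegative integrable function bounded by `M` on a ball around `x` has a finite Riesz
potential at `x`. -/
theorem rieszPotential_le {φ : E → ℝ} (h0 : ∀ y, 0 ≤ φ y) (hφ : Integrable φ) {a r M : ℝ}
    (ha0 : 0 ≤ a) (ha : a < Module.finrank ℝ E) (hr : 0 < r) (x : E)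
    (hM : ∀ y ∈ ball x r, φ y ≤ M) :
    Integrable (fun y => φ y * ‖x - y‖ ^ (-a)) ∧
      ∫ y, φ y * ‖x - y‖ ^ (-a) ≤
        M * kernelMass E a * r ^ (Module.finrank ℝ E - a) + r ^ (-a) * ∫ y, φ y := by
  have hM0 : 0 ≤ M := (h0 x).trans (hM x (mem_ball_self hr))
  set k : E → ℝ := (ball (0 : E) r).indicator fun t => ‖t‖ ^ (-a) with hk
  have hki : Integrable k :=
    (integrable_indicator_iff measurableSet_ball).2 (integrableOn_ball_norm_rpow_neg ha hr)
  have hdom : Integrable fun y => M * k (x - y) + r ^ (-a) * φ y :=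
    ((hki.comp_sub_left x).const_mul M).add (hφ.const_mul _)
  have hle : ∀ y, φ y * ‖x - y‖ ^ (-a) ≤ M * k (x - y) + r ^ (-a) * φ y := by
    intro y
    have h1 : 0 ≤ r ^ (-a) * φ y := mul_nonneg (by positivity) (h0 y)
    by_cases hy : x - y ∈ ball (0 : E) r
    · have hy' : y ∈ ball x r := by
        rwa [mem_ball_zero_iff, ← dist_eq_norm, dist_comm] at hy
      rw [hk, Set.indicator_of_mem hy]
      have := mul_le_mul_of_nonneg_right (hM y hy') (by positivity : 0 ≤ ‖x - y‖ ^ (-a))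
      linarith
    · rw [hk, Set.indicator_of_notMem hy]
      rw [mem_ball_zero_iff, not_lt] at hy
      have := mul_le_mul_of_nonneg_left
        (Real.rpow_le_rpow_of_nonpos hr hy (neg_nonpos.2 ha0)) (h0 y)
      linarith
  have hint : Integrable fun y => φ y * ‖x - y‖ ^ (-a) := by
    refine hdom.mono' (hφ.aestronglyMeasurable.mul ?_) (ae_of_all _ fun y => ?_)
    · exact Measurable.aestronglyMeasurable (by fun_prop)
    · rw [Real.norm_of_nonneg (mul_nonneg (h0 y) (by positivity))]
      exact hle y
  refine ⟨hint, (integral_mono hint hdom hle).trans_eq ?_⟩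
  rw [integral_add ((hki.comp_sub_left x).const_mul M) (hφ.const_mul _), integral_const_mul,
    integral_const_mul, integral_sub_left_eq_self k volume x, hk,
    integral_indicator measurableSet_ball, setIntegral_ball_norm_rpow_neg hr, mul_assoc]

theorem lintegral_ball_rpow_neg_le {b : ℝ} (hb0 : 0 ≤ b) (hb : b < Module.finrank ℝ E) (x y : E) :
    ∫⁻ z in ball x 1, ENNReal.ofReal (‖z - y‖ ^ (-b)) ≤
      ENNReal.ofReal (kernelMass E b) + volume (ball (0 : E) 1) := by
  have hpt : ∀ z, (ball x 1).indicator (fun z => ENNReal.ofReal (‖z - y‖ ^ (-b))) z ≤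
      (ball (0 : E) 1).indicator (fun t => ENNReal.ofReal (‖t‖ ^ (-b))) (z - y) +
        (ball x 1).indicator 1 z := by
    intro z
    by_cases hz : z ∈ ball x 1
    · rw [Set.indicator_of_mem hz, Set.indicator_of_mem hz]
      by_cases hzy : z - y ∈ ball (0 : E) 1
      · rw [Set.indicator_of_mem hzy]
        exact le_self_add
      · rw [Set.indicator_of_notMem hzy, zero_add, Pi.one_apply, ENNReal.ofReal_le_one]
        rw [mem_ball_zero_iff, not_lt] at hzy
        exact Real.rpow_le_one_of_one_le_of_nonpos hzy (neg_nonpos.2 hb0)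
    · rw [Set.indicator_of_notMem hz]
      exact zero_le
  rw [← lintegral_indicator measurableSet_ball]
  refine (lintegral_mono hpt).trans_eq ?_
  rw [lintegral_add_right _ (measurable_one.indicator measurableSet_ball),
    lintegral_indicator_one measurableSet_ball,
    lintegral_sub_right_eq_self
      ((ball (0 : E) 1).indicator fun t => ENNReal.ofReal (‖t‖ ^ (-b))) y,
    lintegral_indicator measurableSet_ball, Measure.addHaar_ball_center, kernelMass,
    ofReal_integral_eq_lintegral_ofReal (integrableOn_ball_norm_rpow_neg hb one_pos)
      (ae_of_all _ fun t => by positivity)]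

theorem rpow_neg_mul_rpow_neg_le {s t a b : ℝ} (hs : 0 ≤ s) (ht : 0 ≤ t) (ha : 0 < a)
    (hb : 0 < b) : s ^ (-a) * t ^ (-b) ≤ s ^ (-(a + b)) + t ^ (-(a + b)) := by
  have hs' : 0 ≤ s ^ (-(a + b)) := by positivity
  have ht' : 0 ≤ t ^ (-(a + b)) := by positivity
  rcases hs.eq_or_lt with rfl | hs
  · rw [Real.zero_rpow (by linarith), zero_mul]
    positivity
  rcases ht.eq_or_lt with rfl | ht
  · rw [Real.zero_rpow (x := -b) (by linarith), mul_zero]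
    positivity
  rcases le_total s t with h | h
  · have := mul_le_mul_of_nonneg_left
      (Real.rpow_le_rpow_of_nonpos hs h (neg_nonpos.2 hb.le)) (by positivity : 0 ≤ s ^ (-a))
    rw [← Real.rpow_add hs, ← neg_add] at this
    linarith
  · have := mul_le_mul_of_nonneg_right
      (Real.rpow_le_rpow_of_nonpos ht h (neg_nonpos.2 ha.le)) (by positivity : 0 ≤ t ^ (-b))
    rw [← Real.rpow_add ht, ← neg_add] at this
    linarith

theorem exists_lintegral_ball_rpow_neg_mul_le {a b : ℝ} (ha : 0 < a) (hb : 0 < b)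
    (hab : a + b < Module.finrank ℝ E) : ∃ K : ℝ, 0 ≤ K ∧ ∀ x y : E,
      ∫⁻ z in ball x 1, ENNReal.ofReal (‖x - z‖ ^ (-a) * ‖z - y‖ ^ (-b)) ≤ ENNReal.ofReal K := by
  have hfin : ENNReal.ofReal (kernelMass E (a + b)) + volume (ball (0 : E) 1) ≠ ⊤ :=
    ENNReal.add_ne_top.2 ⟨ENNReal.ofReal_ne_top, measure_ball_lt_top.ne⟩
  set K0 := ENNReal.ofReal (kernelMass E (a + b)) + volume (ball (0 : E) 1) with hK0
  refine ⟨(K0 + K0).toReal, ENNReal.toReal_nonneg, fun x y => ?_⟩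
  rw [ENNReal.ofReal_toReal (ENNReal.add_ne_top.2 ⟨hfin, hfin⟩)]
  calc ∫⁻ z in ball x 1, ENNReal.ofReal (‖x - z‖ ^ (-a) * ‖z - y‖ ^ (-b))
      ≤ ∫⁻ z in ball x 1, (ENNReal.ofReal (‖z - x‖ ^ (-(a + b))) +
          ENNReal.ofReal (‖z - y‖ ^ (-(a + b)))) := by
        refine lintegral_mono fun z => ?_
        rw [← ENNReal.ofReal_add (by positivity) (by positivity), norm_sub_rev z x]
        exact ENNReal.ofReal_le_ofReal
          (rpow_neg_mul_rpow_neg_le (norm_nonneg _) (norm_nonneg _) ha hb)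
    _ = (∫⁻ z in ball x 1, ENNReal.ofReal (‖z - x‖ ^ (-(a + b)))) +
          ∫⁻ z in ball x 1, ENNReal.ofReal (‖z - y‖ ^ (-(a + b))) :=
        lintegral_add_left (by fun_prop) _
    _ ≤ K0 + K0 := add_le_add (lintegral_ball_rpow_neg_le (by positivity) hab x x)
          (lintegral_ball_rpow_neg_le (by positivity) hab x y)

theorem not_integrable_one_add_norm_rpow_neg_finrank :
    ¬ Integrable fun x : E => (1 + ‖x‖) ^ (-(Module.finrank ℝ E : ℝ)) := by
  intro h
  rw [integrable_fun_norm_addHaar volume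
    (f := fun y : ℝ => (1 + y) ^ (-(Module.finrank ℝ E : ℝ)))] at h
  have hd : 1 ≤ Module.finrank ℝ E := Module.finrank_pos
  set d := Module.finrank ℝ E
  have h1 : IntegrableOn (fun y : ℝ => (2 : ℝ) ^ d * (y ^ (d - 1) • (1 + y) ^ (-(d : ℝ))))
    (Set.Ioi 1) := (h.mono_set (Set.Ioi_subset_Ioi zero_le_one)).const_mul _
  refine not_integrableOn_Ioi_inv (a := 1) (h1.mono' (by fun_prop) ?_)
  refine (ae_restrict_iff' measurableSet_Ioi).2 (ae_of_all _ fun y hy => ?_)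
  have hy1 : (1 : ℝ) < y := hy
  have hy0 : 0 < y := by linarith
  rw [Real.norm_of_nonneg (by positivity), smul_eq_mul, Real.rpow_neg (by positivity),
    Real.rpow_natCast]
  have hq : (1 + y) ^ d ≤ (2 * y) ^ d := by gcongr; linarith
  have hyd : y ^ d = y ^ (d - 1) * y := by rw [← pow_succ, Nat.sub_add_cancel hd]
  rw [mul_pow, hyd] at hq
  rw [← mul_assoc, ← div_eq_mul_inv, le_div_iff₀ (by positivity), inv_mul_le_iff₀ hy0]
  linarith

end Kernel

section LogPotential

variable {E : Type*} [NormedAddCommGroup E]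

theorem max_neg_log_le_rpow_neg_div {t a : ℝ} (ht : 0 ≤ t) (ha : 0 < a) :
    max 0 (-Real.log t) ≤ t ^ (-a) / a := by
  refine max_le (by positivity) ?_
  rw [← Real.log_inv, Real.rpow_neg ht, ← Real.inv_rpow ht]
  exact Real.log_le_rpow_div (by positivity) ha

theorem exp_mul_max_neg_log_le {t a : ℝ} (ht : 0 ≤ t) :
    exp (a * max 0 (-Real.log t)) ≤ 1 + t ^ (-a) := by
  have hp : 0 ≤ t ^ (-a) := by positivity
  rcases le_total (-Real.log t) 0 with h | h
  · rw [max_eq_left h, mul_zero, Real.exp_zero]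
    linarith
  · rcases ht.eq_or_lt with rfl | ht
    · rw [Real.log_zero, neg_zero, max_self, mul_zero, Real.exp_zero]
      linarith
    · rw [max_eq_right h, Real.rpow_def_of_pos ht, show a * -Real.log t = Real.log t * -a by ring]
      linarith

theorem neg_log_le_log_div_norm_sub (x y : E) :
    -Real.log (‖x‖ + 1) ≤ Real.log ((‖y‖ + 1) / ‖x - y‖) := by
  have hx := norm_nonneg x
  have hy := norm_nonneg y
  rcases (norm_nonneg (x - y)).eq_or_lt with h | h
  · rw [← h, div_zero, Real.log_zero, neg_nonpos]
    exact Real.log_nonneg (by linarith)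
  · rw [← Real.log_inv]
    refine Real.log_le_log (by positivity) ?_
    rw [le_div_iff₀ h, inv_mul_le_iff₀ (by positivity)]
    nlinarith [norm_sub_le x y, mul_nonneg hx hy]

theorem log_div_norm_sub_le (x y : E) :
    Real.log ((‖y‖ + 1) / ‖x - y‖) ≤ Real.log (‖x‖ + 2) + max 0 (-Real.log ‖x - y‖) := by
  have hx := norm_nonneg x
  have hy := norm_nonneg y
  have hxy : ‖y‖ ≤ ‖x‖ + ‖x - y‖ := by
    simpa using norm_sub_le x (x - y)
  have hl : 0 ≤ Real.log (‖x‖ + 2) := Real.log_nonneg (by linarith)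
  rcases (norm_nonneg (x - y)).eq_or_lt with h | h
  · rw [← h, div_zero, Real.log_zero, neg_zero, max_self]
    linarith
  · rcases le_total 1 ‖x - y‖ with h1 | h1
    · have : Real.log ((‖y‖ + 1) / ‖x - y‖) ≤ Real.log (‖x‖ + 2) := by
        refine Real.log_le_log (by positivity) ?_
        rw [div_le_iff₀ h]
        nlinarith
      have := le_max_left 0 (-Real.log ‖x - y‖)
      linarith
    · rw [Real.log_div (by positivity) h.ne']
      have : Real.log (‖y‖ + 1) ≤ Real.log (‖x‖ + 2) :=
        Real.log_le_log (by positivity) (by linarith)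
      have := le_max_right 0 (-Real.log ‖x - y‖)
      linarith

theorem abs_log_div_norm_sub_le {a : ℝ} (ha : 0 < a) (x y : E) :
    |Real.log ((‖y‖ + 1) / ‖x - y‖)| ≤ Real.log (‖x‖ + 2) + ‖x - y‖ ^ (-a) / a := by
  have hx := norm_nonneg x
  have h1 := neg_log_le_log_div_norm_sub x y
  have h2 := log_div_norm_sub_le x y
  have h3 := max_neg_log_le_rpow_neg_div (norm_nonneg (x - y)) ha
  have h4 : Real.log (‖x‖ + 1) ≤ Real.log (‖x‖ + 2) :=
    Real.log_le_log (by positivity) (by linarith)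
  have h5 := le_max_left 0 (-Real.log ‖x - y‖)
  exact abs_le.2 ⟨by linarith, by linarith⟩

theorem exists_setIntegral_compl_closedBall_le [MeasureSpace E] [BorelSpace E] {m : E → ℝ}
    (hm : Integrable m) {δ : ℝ} (hδ : 0 < δ) : ∃ R : ℝ, 0 ≤ R ∧ ∫ y in (closedBall (0 : E) R)ᶜ, m y ≤ δ := by
  have h := tendsto_setIntegral_of_antitone (μ := volume) (f := m)
    (s := fun i : ℕ => (closedBall (0 : E) i)ᶜ) (fun i => measurableSet_closedBall.compl)
    (fun i j hij => Set.compl_subset_compl.2 (closedBall_subset_closedBall (by exact_mod_cast hij)))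
    ⟨0, hm.integrableOn⟩
  have he : ⋂ i : ℕ, (closedBall (0 : E) i)ᶜ = ∅ := by
    rw [← Set.compl_iUnion, iUnion_closedBall_nat, Set.compl_univ]
  rw [he, setIntegral_empty] at h
  obtain ⟨i, hi⟩ := (h.eventually (gt_mem_nhds hδ)).exists
  exact ⟨i, Nat.cast_nonneg i, hi.le⟩

variable [NormedSpace ℝ E] [FiniteDimensional ℝ E]
  [MeasureSpace E] [BorelSpace E] [Nontrivial E] [(volume : Measure E).IsAddHaarMeasure]

theorem integrable_log_div_norm_sub_mul {m : E → ℝ} (h0 : ∀ y, 0 ≤ m y) (hm : Integrable m)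
    (x : E) {M : ℝ} (hM : ∀ y ∈ ball x 1, m y ≤ M) :
    Integrable fun y => Real.log ((‖y‖ + 1) / ‖x - y‖) * m y := by
  have hd : (0 : ℝ) < Module.finrank ℝ E := Nat.cast_pos.2 Module.finrank_pos
  have hr := (rieszPotential_le h0 hm (a := Module.finrank ℝ E / 2) (by positivity) (by linarith)
    one_pos x hM).1
  refine ((hm.const_mul (Real.log (‖x‖ + 2))).add
    (hr.const_mul (Module.finrank ℝ E / 2 : ℝ)⁻¹)).mono'
    (AEStronglyMeasurable.mul (Measurable.aestronglyMeasurable (by fun_prop))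
      hm.aestronglyMeasurable) (ae_of_all _ fun y => ?_)
  rw [norm_mul, Real.norm_eq_abs, Real.norm_of_nonneg (h0 y)]
  refine (mul_le_mul_of_nonneg_right (abs_log_div_norm_sub_le (half_pos hd) x y) (h0 y)).trans_eq ?_
  simp only [Pi.add_apply]
  ring

theorem integrable_max_neg_log_mul {m : E → ℝ} (h0 : ∀ y, 0 ≤ m y) (hm : Integrable m)
    (x : E) {M : ℝ} (hM : ∀ y ∈ ball x 1, m y ≤ M) :
    Integrable fun y => max 0 (-Real.log ‖x - y‖) * m y := by
  have hd : (0 : ℝ) < Module.finrank ℝ E := Nat.cast_pos.2 Module.finrank_pos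
  have hr := (rieszPotential_le h0 hm (a := Module.finrank ℝ E / 2) (by positivity) (by linarith)
    one_pos x hM).1
  refine (hr.const_mul (Module.finrank ℝ E / 2 : ℝ)⁻¹).mono'
    (AEStronglyMeasurable.mul (Measurable.aestronglyMeasurable (by fun_prop))
      hm.aestronglyMeasurable) (ae_of_all _ fun y => ?_)
  rw [norm_mul, Real.norm_of_nonneg (le_max_left _ _), Real.norm_of_nonneg (h0 y)]
  refine (mul_le_mul_of_nonneg_right
    (max_neg_log_le_rpow_neg_div (norm_nonneg _) (half_pos hd)) (h0 y)).trans_eq ?_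
  ring

theorem neg_log_mul_integral_le {m : E → ℝ} (h0 : ∀ y, 0 ≤ m y) (hm : Integrable m)
    (x : E) {M : ℝ} (hM : ∀ y ∈ ball x 1, m y ≤ M) :
    -Real.log (‖x‖ + 1) * ∫ y, m y ≤ ∫ y, Real.log ((‖y‖ + 1) / ‖x - y‖) * m y := by
  rw [← integral_const_mul]
  exact integral_mono (hm.const_mul _) (integrable_log_div_norm_sub_mul h0 hm x hM) fun y =>
    mul_le_mul_of_nonneg_right (neg_log_le_log_div_norm_sub x y) (h0 y)

/-- Away from a fixed ball, the logarithmic potential is controlled by `-log ‖z‖` times the mass of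
that ball, up to the mass outside and the local part of the potential. -/
theorem integral_log_div_norm_sub_mul_le {m : E → ℝ} (h0 : ∀ y, 0 ≤ m y) (hm : Integrable m)
    {z : E} {M : ℝ} (hM : ∀ y ∈ ball z 1, m y ≤ M) {R : ℝ} (hR : 0 ≤ R) (hz : 2 * (R + 1) ≤ ‖z‖) :
    ∫ y, Real.log ((‖y‖ + 1) / ‖z - y‖) * m y ≤
      (Real.log (2 * (R + 1)) - Real.log ‖z‖) * (∫ y in closedBall 0 R, m y) +
      (Real.log 2 + Real.log ‖z‖) * (∫ y in (closedBall 0 R)ᶜ, m y) +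
      ∫ y in (closedBall 0 R)ᶜ, max 0 (-Real.log ‖z - y‖) * m y := by
  have hz0 : 0 < ‖z‖ := by linarith
  have hi := integrable_log_div_norm_sub_mul h0 hm z hM
  have hl := integrable_max_neg_log_mul h0 hm z hM
  rw [← integral_add_compl (measurableSet_closedBall (x := (0 : E)) (ε := R)) hi, add_assoc]
  refine add_le_add ?_ ?_
  · rw [← integral_const_mul]
    refine setIntegral_mono_on hi.integrableOn (hm.const_mul _).integrableOn
      measurableSet_closedBall fun y hy => mul_le_mul_of_nonneg_right ?_ (h0 y)
    rw [mem_closedBall_zero_iff] at hy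
    have hzy : ‖z‖ / 2 ≤ ‖z - y‖ := by linarith [norm_sub_norm_le z y]
    rw [← Real.log_div (by positivity) hz0.ne']
    refine Real.log_le_log (div_pos (by positivity) (by linarith)) ?_
    rw [div_le_div_iff₀ (by linarith) hz0]
    nlinarith
  · rw [← integral_const_mul, ← integral_add (hm.const_mul _).integrableOn hl.integrableOn]
    refine setIntegral_mono_on hi.integrableOn
      ((hm.const_mul _).add hl).integrableOn
      measurableSet_closedBall.compl fun y _ => ?_
    rw [← add_mul]
    refine mul_le_mul_of_nonneg_right ((log_div_norm_sub_le z y).trans ?_) (h0 y)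
    have : Real.log (‖z‖ + 2) ≤ Real.log 2 + Real.log ‖z‖ := by
      rw [← Real.log_mul two_ne_zero hz0.ne']
      exact Real.log_le_log (by positivity) (by linarith)
    linarith

/-- If `u` is the logarithmic potential of `m` up to a constant and `k` times the mass of `m`
exceeds the dimension, then `exp (k * u)` decays like `‖z‖ ^ (-d)` up to a local factor. -/
theorem exists_exp_mul_le_of_logPotential {m u : E → ℝ} (h0 : ∀ y, 0 ≤ m y) (hm : Integrable m)
    (hM : ∀ x, ∃ M, ∀ y ∈ ball x 1, m y ≤ M) {C k η : ℝ} (hk : 0 < k) (hη : 0 < η)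
    (hu : ∀ x, u x = (∫ y, Real.log ((‖y‖ + 1) / ‖x - y‖) * m y) + C)
    (hα : Module.finrank ℝ E < k * ∫ y, m y) :
    ∃ R δ A : ℝ, 0 ≤ R ∧ 0 < δ ∧ δ ≤ η ∧ 0 ≤ A ∧ ∫ y in (closedBall (0 : E) R)ᶜ, m y ≤ δ ∧
      ∀ z, 2 * (R + 1) ≤ ‖z‖ → exp (k * u z) ≤ A * ‖z‖ ^ (-(Module.finrank ℝ E : ℝ)) *
        exp (k * ∫ y in (closedBall (0 : E) R)ᶜ, max 0 (-Real.log ‖z - y‖) * m y) := by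
  set α := ∫ y, m y
  set d : ℝ := (Module.finrank ℝ E : ℝ)
  have hδ : 0 < min η ((k * α - d) / (2 * k)) :=
    lt_min hη (div_pos (sub_pos.2 hα) (by positivity))
  obtain ⟨R, hR, hRm⟩ := exists_setIntegral_compl_closedBall_le hm hδ
  have hs : (∫ y in closedBall (0 : E) R, m y) + ∫ y in (closedBall (0 : E) R)ᶜ, m y = α :=
    integral_add_compl measurableSet_closedBall hm
  have hle2 := hRm.trans (min_le_right _ _)
  set mi := ∫ y in closedBall (0 : E) R, m y
  set mo := ∫ y in (closedBall (0 : E) R)ᶜ, m y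
  refine ⟨R, _, exp (k * (C + Real.log (2 * (R + 1)) * mi + Real.log 2 * mo)), hR, hδ,
    min_le_left _ _, (Real.exp_pos _).le, hRm, fun z hz => ?_⟩
  have hz1 : 1 ≤ ‖z‖ := by linarith
  obtain ⟨M, hM⟩ := hM z
  have h := integral_log_div_norm_sub_mul_le h0 hm hM hR hz
  set g := ∫ y in (closedBall (0 : E) R)ᶜ, max 0 (-Real.log ‖z - y‖) * m y
  rw [Real.rpow_def_of_pos (by linarith), ← Real.exp_add, ← Real.exp_add]
  refine Real.exp_le_exp.2 ?_
  have hl : 0 ≤ Real.log ‖z‖ := Real.log_nonneg hz1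
  rw [le_div_iff₀ (by positivity)] at hle2
  have h1 : d ≤ k * (mi - mo) := by rw [← hs] at hle2; linarith
  have h2 := mul_le_mul_of_nonneg_right h1 hl
  have h3 := mul_le_mul_of_nonneg_left h hk.le
  rw [hu z]
  linarith

end LogPotential

section Regularity

theorem exists_le_on_closedBall {E : Type*} [PseudoMetricSpace E] [ProperSpace E] {f : E → ℝ}
    (hf : Continuous f) (x : E) (r : ℝ) : ∃ M, ∀ y ∈ closedBall x r, f y ≤ M := by
  obtain ⟨M, hM⟩ := (isCompact_closedBall x r).exists_bound_of_continuousOn hf.continuousOn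
  exact ⟨M, fun y hy => (le_abs_self _).trans (hM y hy)⟩

variable {E : Type*} [NormedAddCommGroup E] [NormedSpace ℝ E] [FiniteDimensional ℝ E]
  [MeasureSpace E] [BorelSpace E] [Nontrivial E] [(volume : Measure E).IsAddHaarMeasure]

theorem exp_integral_max_neg_log_le {φ : E → ℝ} (h0 : ∀ y, 0 ≤ φ y) (hφ : Integrable φ)
    (hφ1 : ∫ y, φ y ≤ 1) {a : ℝ} (ha : 0 < a) (had : a < Module.finrank ℝ E) (z : E) {M : ℝ}
    (hM : ∀ y ∈ ball z 1, φ y ≤ M) :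
    exp (∫ y, φ y * (a * max 0 (-Real.log ‖z - y‖))) ≤ 2 + ∫ y, φ y * ‖z - y‖ ^ (-a) := by
  have hr := (rieszPotential_le h0 hφ ha.le had one_pos z hM).1
  have hle : ∀ y, φ y * exp (a * max 0 (-Real.log ‖z - y‖)) ≤ φ y + φ y * ‖z - y‖ ^ (-a) := by
    intro y
    have := mul_le_mul_of_nonneg_left
      (exp_mul_max_neg_log_le (t := ‖z - y‖) (a := a) (norm_nonneg _)) (h0 y)
    linarith
  have he : Integrable fun y => φ y * exp (a * max 0 (-Real.log ‖z - y‖)) := by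
    refine (hφ.add hr).mono' (hφ.aestronglyMeasurable.mul
      (Measurable.aestronglyMeasurable (by fun_prop))) (ae_of_all _ fun y => ?_)
    rw [Real.norm_of_nonneg (mul_nonneg (h0 y) (Real.exp_pos _).le)]
    exact hle y
  have hL : Integrable fun y => φ y * (a * max 0 (-Real.log ‖z - y‖)) :=
    ((integrable_max_neg_log_mul h0 hφ z hM).const_mul a).congr (ae_of_all _ fun y => by ring)
  have h1 := exp_integral_mul_le h0 hφ hφ1 hL he
  have h2 := integral_mono he (hφ.add hr) hle
  simp only [Pi.add_apply] at h2
  rw [integral_add hφ hr] at h2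
  linarith

theorem exists_lintegral_ball_rieszPotential_le {φ : E → ℝ} (h0 : ∀ y, 0 ≤ φ y)
    (hφ : Integrable φ) (hφ1 : ∫ y, φ y ≤ 1) {a b : ℝ} (ha : 0 < a) (hb : 0 < b)
    (hab : b + a < Module.finrank ℝ E) (hM : ∀ x, ∃ M, ∀ y ∈ ball x 1, φ y ≤ M) :
    ∃ K : ℝ, 0 ≤ K ∧ ∀ x : E, ∫⁻ z in ball x 1,
      ENNReal.ofReal (‖x - z‖ ^ (-b) * (2 + ∫ y, φ y * ‖z - y‖ ^ (-a))) ≤ ENNReal.ofReal K := by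
  obtain ⟨K, hK0, hK⟩ := exists_lintegral_ball_rpow_neg_mul_le (E := E) hb ha hab
  have hfin : ENNReal.ofReal (kernelMass E b) + volume (ball (0 : E) 1) ≠ ⊤ :=
    ENNReal.add_ne_top.2 ⟨ENNReal.ofReal_ne_top, measure_ball_lt_top.ne⟩
  set K₁ := (ENNReal.ofReal (kernelMass E b) + volume (ball (0 : E) 1)).toReal with hK₁
  refine ⟨2 * K₁ + K, by positivity, fun x => ?_⟩
  have hpt : ∀ z, ENNReal.ofReal (‖x - z‖ ^ (-b) * (2 + ∫ y, φ y * ‖z - y‖ ^ (-a))) =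
      2 * ENNReal.ofReal (‖z - x‖ ^ (-b)) +
        ∫⁻ y, ENNReal.ofReal (φ y) * ENNReal.ofReal (‖x - z‖ ^ (-b) * ‖z - y‖ ^ (-a)) := by
    intro z
    obtain ⟨M, hM⟩ := hM z
    have hr := (rieszPotential_le h0 hφ ha.le (by linarith) one_pos z hM).1
    have hr0 : ∀ y, 0 ≤ φ y * ‖z - y‖ ^ (-a) := fun y => mul_nonneg (h0 y) (by positivity)
    rw [mul_add, ENNReal.ofReal_add (by positivity)
      (mul_nonneg (by positivity) (integral_nonneg hr0)), mul_comm (‖x - z‖ ^ (-b)) 2,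
      ENNReal.ofReal_mul zero_le_two, ENNReal.ofReal_ofNat, norm_sub_rev, ← integral_const_mul,
      ofReal_integral_eq_lintegral_ofReal (hr.const_mul _)
        (ae_of_all _ fun y => mul_nonneg (by positivity) (hr0 y))]
    congr 1
    refine lintegral_congr fun y => ?_
    rw [← ENNReal.ofReal_mul (h0 y)]
    congr 1
    ring
  simp_rw [hpt]
  rw [lintegral_add_left (by fun_prop), lintegral_const_mul _ (by fun_prop),
    lintegral_lintegral_swap]
  · rw [ENNReal.ofReal_add (by positivity) hK0, ENNReal.ofReal_mul zero_le_two,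
      ENNReal.ofReal_ofNat, hK₁, ENNReal.ofReal_toReal hfin]
    refine add_le_add (mul_le_mul_right (lintegral_ball_rpow_neg_le hb.le (by linarith) x x) _) ?_
    calc ∫⁻ y, ∫⁻ z in ball x 1,
          ENNReal.ofReal (φ y) * ENNReal.ofReal (‖x - z‖ ^ (-b) * ‖z - y‖ ^ (-a))
        ≤ ∫⁻ y, ENNReal.ofReal (φ y) * ENNReal.ofReal K := by
          refine lintegral_mono fun y => ?_
          rw [lintegral_const_mul _ (by fun_prop)]
          exact mul_le_mul_right (hK x y) _
      _ = ENNReal.ofReal (∫ y, φ y) * ENNReal.ofReal K := by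
          rw [lintegral_mul_const' _ _ ENNReal.ofReal_ne_top,
            ofReal_integral_eq_lintegral_ofReal hφ (ae_of_all _ h0)]
      _ ≤ 1 * ENNReal.ofReal K := by
          gcongr
          exact ENNReal.ofReal_le_one.2 hφ1
      _ = ENNReal.ofReal K := one_mul _
  · refine AEMeasurable.mul (AEMeasurable.comp_snd hφ.aemeasurable.ennreal_ofReal) ?_
    exact Measurable.aemeasurable (by fun_prop)

theorem exists_rieszPotential_le_on_closedBall {f : E → ℝ} (h0 : ∀ y, 0 ≤ f y)
    (hf : Integrable f) (hc : Continuous f) {b : ℝ} (hb : 0 ≤ b) (hbd : b < Module.finrank ℝ E)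
    (ρ : ℝ) : ∃ M, 0 ≤ M ∧ ∀ x ∈ closedBall (0 : E) ρ, ∫ y, f y * ‖x - y‖ ^ (-b) ≤ M := by
  obtain ⟨M, hM⟩ := exists_le_on_closedBall hc 0 (ρ + 1)
  refine ⟨max 0 (M * kernelMass E b * 1 ^ (Module.finrank ℝ E - b) + 1 ^ (-b) * ∫ y, f y),
    le_max_left _ _, fun x hx => le_max_of_le_right ?_⟩
  refine (rieszPotential_le h0 hf hb hbd one_pos x fun y hy => hM y ?_).2
  rw [mem_closedBall_zero_iff] at hx ⊢
  have := mem_ball_iff_norm.1 hy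
  have := norm_le_norm_add_norm_sub' y x
  linarith

/-- A function dominated at infinity by the exponential of a local logarithmic potential with small
mass has a bounded Riesz potential. -/
theorem exists_rieszPotential_le {f m : E → ℝ} (hf0 : ∀ y, 0 ≤ f y) (hf : Integrable f)
    (hfc : Continuous f) (hm0 : ∀ y, 0 ≤ m y) (hm : Integrable m)
    (hM : ∀ x, ∃ M, ∀ y ∈ ball x 1, m y ≤ M) {b k R δ A : ℝ} (hb : 0 < b) (hk : 0 < k)
    (hδ : 0 < δ) (hA : 0 ≤ A) (hbk : b + k * δ < Module.finrank ℝ E)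
    (hR : ∫ y in (closedBall (0 : E) R)ᶜ, m y ≤ δ)
    (hfm : ∀ z, 2 * (R + 1) ≤ ‖z‖ → f z ≤
      A * exp (k * ∫ y in (closedBall (0 : E) R)ᶜ, max 0 (-Real.log ‖z - y‖) * m y)) :
    ∃ B, 0 ≤ B ∧ ∀ x, ∫ y, f y * ‖x - y‖ ^ (-b) ≤ B := by
  have hs : MeasurableSet (closedBall (0 : E) R)ᶜ := measurableSet_closedBall.compl
  set φ : E → ℝ := (closedBall (0 : E) R)ᶜ.indicator fun y => δ⁻¹ * m y with hφdef
  have hφ0 : ∀ y, 0 ≤ φ y := fun y =>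
    Set.indicator_nonneg (fun y _ => mul_nonneg (by positivity) (hm0 y)) y
  have hφ : Integrable φ := (hm.const_mul _).indicator hs
  have hφ1 : ∫ y, φ y ≤ 1 := by
    rw [hφdef, integral_indicator hs, integral_const_mul, inv_mul_le_iff₀ hδ, mul_one]
    exact hR
  have hφM : ∀ x, ∃ M, ∀ y ∈ ball x 1, φ y ≤ M := fun x => by
    obtain ⟨M, hM⟩ := hM x
    refine ⟨δ⁻¹ * M, fun y hy => (Set.indicator_le_self' (fun _ _ =>
      mul_nonneg (by positivity) (hm0 _)) y).trans ?_⟩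
    exact mul_le_mul_of_nonneg_left (hM y hy) (by positivity)
  have ha : 0 < k * δ := by positivity
  obtain ⟨K, hK0, hK⟩ := exists_lintegral_ball_rieszPotential_le hφ0 hφ hφ1 ha hb hbk hφM
  obtain ⟨M, hM0, hMv⟩ := exists_rieszPotential_le_on_closedBall hf0 hf hfc hb.le (by linarith)
    (2 * (R + 1) + 1)
  have hFi : 0 ≤ ∫ y, f y := integral_nonneg hf0
  refine ⟨M + (A * K + ∫ y, f y), by positivity, fun x => ?_⟩
  rcases le_or_gt ‖x‖ (2 * (R + 1) + 1) with hx | hx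
  · exact (hMv x (mem_closedBall_zero_iff.2 hx)).trans (le_add_of_nonneg_right (by positivity))
  refine le_trans ?_ (le_add_of_nonneg_left hM0)
  obtain ⟨Mf, hMf⟩ := exists_le_on_closedBall hfc x 1
  have hi := (rieszPotential_le hf0 hf hb.le (by linarith) one_pos x
    fun y hy => hMf y (ball_subset_closedBall hy)).1
  rw [← integral_add_compl (measurableSet_ball (x := x) (ε := 1)) hi]
  refine add_le_add ?_ ?_
  · rw [← ENNReal.ofReal_le_ofReal_iff (by positivity), ofReal_integral_eq_lintegral_ofReal
      hi.integrableOn (ae_of_all _ fun y => mul_nonneg (hf0 y) (by positivity)),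
      ENNReal.ofReal_mul hA]
    refine le_trans ?_ (mul_le_mul_right (hK x) _)
    rw [← lintegral_const_mul' _ _ ENNReal.ofReal_ne_top]
    refine setLIntegral_mono' measurableSet_ball fun z hz => ?_
    rw [← ENNReal.ofReal_mul hA]
    refine ENNReal.ofReal_le_ofReal ?_
    have hz1 : 2 * (R + 1) ≤ ‖z‖ := by
      have := mem_ball_iff_norm'.1 hz
      linarith [norm_sub_norm_le x z]
    obtain ⟨M', hM'⟩ := hφM z
    have hj := exp_integral_max_neg_log_le hφ0 hφ hφ1 ha (by linarith) z hM'
    have he : ∫ y, φ y * (k * δ * max 0 (-Real.log ‖z - y‖)) =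
        k * ∫ y in (closedBall (0 : E) R)ᶜ, max 0 (-Real.log ‖z - y‖) * m y := by
      rw [← integral_const_mul, ← integral_indicator hs]
      refine integral_congr_ae (ae_of_all _ fun y => ?_)
      by_cases hy : y ∈ (closedBall (0 : E) R)ᶜ
      · simp only [hφdef, Set.indicator_of_mem hy]
        field_simp
      · simp only [hφdef, Set.indicator_of_notMem hy, zero_mul]
    rw [he] at hj
    have h1 := (hfm z hz1).trans (mul_le_mul_of_nonneg_left hj hA)
    have h2 := mul_le_mul_of_nonneg_right h1 (by positivity : 0 ≤ ‖x - z‖ ^ (-b))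
    linarith
  · refine (setIntegral_mono_on hi.integrableOn hf.integrableOn measurableSet_ball.compl
      fun y hy => ?_).trans (setIntegral_le_integral hf (ae_of_all _ hf0))
    refine mul_le_of_le_one_right (hf0 y)
      (Real.rpow_le_one_of_one_le_of_nonpos ?_ (neg_nonpos.2 hb.le))
    rwa [Set.mem_compl_iff, mem_ball_iff_norm', not_lt] at hy

end Regularity

section Gradient

variable {E : Type*} [NormedAddCommGroup E] [NormedSpace ℝ E]

theorem abs_log_sub_log_le {s t : ℝ} (hs : 0 < s) (ht : 0 < t) :
    |Real.log s - Real.log t| ≤ |s - t| * (s⁻¹ + t⁻¹) := by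
  have key : ∀ {s t : ℝ}, 0 < s → 0 < t → Real.log s - Real.log t ≤ |s - t| * t⁻¹ := by
    intro s t hs ht
    rw [← Real.log_div hs.ne' ht.ne']
    have h := Real.log_le_sub_one_of_pos (div_pos hs ht)
    have h2 : s / t - 1 = (s - t) * t⁻¹ := by field_simp
    rw [h2] at h
    exact h.trans (mul_le_mul_of_nonneg_right (le_abs_self _) (by positivity))
  have h1 := key hs ht
  have h2 := key ht hs
  rw [abs_sub_comm t s] at h2
  have h3 : 0 ≤ |s - t| * t⁻¹ := by positivity
  have h4 : 0 ≤ |s - t| * s⁻¹ := by positivity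
  rw [mul_add]
  exact abs_le.2 ⟨by linarith, by linarith⟩

theorem abs_rpow_neg_sub_rpow_neg_le {b ρ s t : ℝ} (hb : 0 < b) (hρ : 0 < ρ) (hs : ρ ≤ s)
    (ht : ρ ≤ t) : |s ^ (-b) - t ^ (-b)| ≤ b * ρ ^ (-b - 1) * |s - t| := by
  have hpos : ∀ y ∈ Set.Ici ρ, 0 < y := fun y hy => hρ.trans_le hy
  refine (convex_Ici ρ).norm_image_sub_le_of_norm_deriv_le (f := fun y : ℝ => y ^ (-b))
    (fun y hy => (Real.hasDerivAt_rpow_const (Or.inl (hpos y hy).ne')).differentiableAt)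
    (fun y hy => ?_) ht hs
  rw [(Real.hasDerivAt_rpow_const (Or.inl (hpos y hy).ne')).deriv, norm_mul, norm_neg,
    Real.norm_of_nonneg hb.le, Real.norm_of_nonneg (Real.rpow_nonneg (hpos y hy).le _)]
  exact mul_le_mul_of_nonneg_left (Real.rpow_le_rpow_of_nonpos hρ hy (by linarith)) hb.le

variable [FiniteDimensional ℝ E] [MeasureSpace E] [BorelSpace E] [Nontrivial E]
  [(volume : Measure E).IsAddHaarMeasure]

theorem exists_rieszPotential_le_of_decay {w : E → ℝ} (h0 : ∀ y, 0 ≤ w y) (hw : Integrable w)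
    {a A S : ℝ} (ha0 : 0 ≤ a) (ha : a < Module.finrank ℝ E) (hA : 0 ≤ A) (hS : 0 < S)
    (hwA : ∀ z, S ≤ ‖z‖ → w z ≤ A * ‖z‖ ^ (-(Module.finrank ℝ E : ℝ))) :
    ∃ D, 0 ≤ D ∧ ∀ x, 2 * S ≤ ‖x‖ → Integrable (fun y => w y * ‖x - y‖ ^ (-a)) ∧
      ∫ y, w y * ‖x - y‖ ^ (-a) ≤ D * (‖x‖ / 2) ^ (-a) := by
  have hk := kernelMass_nonneg (E := E) a
  have hi : 0 ≤ ∫ y, w y := integral_nonneg h0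
  refine ⟨A * kernelMass E a + ∫ y, w y, by positivity, fun x hx => ?_⟩
  have hr : 0 < ‖x‖ / 2 := by linarith
  have h := rieszPotential_le h0 hw ha0 ha hr x
    (M := A * (‖x‖ / 2) ^ (-(Module.finrank ℝ E : ℝ))) fun y hy => by
      have hy' : ‖x‖ / 2 ≤ ‖y‖ := by
        have := mem_ball_iff_norm'.1 hy
        linarith [norm_sub_norm_le x y]
      refine (hwA y (by linarith)).trans (mul_le_mul_of_nonneg_left ?_ hA)
      exact Real.rpow_le_rpow_of_nonpos hr hy' (by simp)
  refine ⟨h.1, h.2.trans_eq ?_⟩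
  have he : (‖x‖ / 2) ^ (-(Module.finrank ℝ E : ℝ)) * (‖x‖ / 2) ^ ((Module.finrank ℝ E : ℝ) - a) =
      (‖x‖ / 2) ^ (-a) := by
    rw [← Real.rpow_add hr]
    congr 1
    ring
  linear_combination A * kernelMass E a * he

/-- The gradient of the logarithmic potential of a density of order `‖z‖ ^ (-d)` is of order
`‖x‖⁻¹`. -/
theorem exists_norm_fderiv_logPotential_le {m u : E → ℝ} (h0 : ∀ y, 0 ≤ m y) (hm : Integrable m)
    (hM : ∀ x, ∃ M, ∀ y ∈ ball x 1, m y ≤ M) {C A S : ℝ} (hd : 1 < Module.finrank ℝ E)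
    (hu : ∀ x, u x = (∫ y, Real.log ((‖y‖ + 1) / ‖x - y‖) * m y) + C) (hA : 0 ≤ A) (hS : 0 < S)
    (hmA : ∀ z, S ≤ ‖z‖ → m z ≤ A * ‖z‖ ^ (-(Module.finrank ℝ E : ℝ))) :
    ∃ D, 0 ≤ D ∧ ∀ x, 4 * S ≤ ‖x‖ → ‖fderiv ℝ u x‖ ≤ D * ‖x‖⁻¹ := by
  obtain ⟨D, hD0, hD⟩ := exists_rieszPotential_le_of_decay h0 hm zero_le_one
    (by exact_mod_cast hd) hA hS hmA
  refine ⟨6 * D, by positivity, fun x hx => ?_⟩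
  have hx0 : 0 < ‖x‖ := by linarith
  refine norm_fderiv_le_of_lip' ℝ (by positivity) ?_
  filter_upwards [ball_mem_nhds x (half_pos hx0)] with x' hx'
  have hx1 : ‖x‖ / 2 ≤ ‖x'‖ := by
    have := mem_ball_iff_norm'.1 hx'
    linarith [norm_sub_norm_le x x']
  have h1 := hD x (by linarith)
  have h2 := hD x' (by linarith)
  obtain ⟨M, hMx⟩ := hM x
  obtain ⟨M', hMx'⟩ := hM x'
  have hi := integrable_log_div_norm_sub_mul h0 hm x hMx
  have hi' := integrable_log_div_norm_sub_mul h0 hm x' hMx'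
  rw [hu x', hu x, add_sub_add_right_eq_sub, ← integral_sub hi' hi]
  have hle : ∀ᵐ y, ‖Real.log ((‖y‖ + 1) / ‖x' - y‖) * m y -
      Real.log ((‖y‖ + 1) / ‖x - y‖) * m y‖ ≤
      ‖x' - x‖ * (m y * ‖x - y‖ ^ (-1 : ℝ) + m y * ‖x' - y‖ ^ (-1 : ℝ)) := by
    filter_upwards [Measure.ae_ne volume x, Measure.ae_ne volume x'] with y hy hy'
    have hp : 0 < ‖x - y‖ := norm_pos_iff.2 (sub_ne_zero.2 hy.symm)
    have hp' : 0 < ‖x' - y‖ := norm_pos_iff.2 (sub_ne_zero.2 hy'.symm)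
    have hl := abs_log_sub_log_le hp hp'
    have hn : |‖x - y‖ - ‖x' - y‖| ≤ ‖x' - x‖ := by
      refine (abs_norm_sub_norm_le _ _).trans_eq ?_
      rw [sub_sub_sub_cancel_right, norm_sub_rev]
    rw [← sub_mul, norm_mul, Real.norm_of_nonneg (h0 y), Real.log_div (by positivity) hp'.ne',
      Real.log_div (by positivity) hp.ne', sub_sub_sub_cancel_left, Real.norm_eq_abs,
      Real.rpow_neg_one, Real.rpow_neg_one]
    have h3 := hl.trans (mul_le_mul_of_nonneg_right hn (by positivity))
    exact (mul_le_mul_of_nonneg_right h3 (h0 y)).trans_eq (by ring)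
  refine (norm_integral_le_of_norm_le ((h1.1.add h2.1).const_mul _) hle).trans ?_
  rw [integral_const_mul, mul_comm ‖x' - x‖]
  refine mul_le_mul_of_nonneg_right ?_ (norm_nonneg _)
  rw [integral_add' h1.1 h2.1]
  have h3 : (‖x'‖ / 2) ^ (-1 : ℝ) ≤ 4 * ‖x‖⁻¹ := by
    rw [Real.rpow_neg_one, inv_div, div_eq_mul_inv, show (4 : ℝ) = 2 * 2 by norm_num, mul_assoc]
    have := inv_anti₀ (half_pos hx0) hx1
    rw [inv_div, div_eq_mul_inv] at this
    linarith
  have h4 : (‖x‖ / 2) ^ (-1 : ℝ) = 2 * ‖x‖⁻¹ := by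
    rw [Real.rpow_neg_one, inv_div, div_eq_mul_inv]
  have h5 := h1.2
  rw [h4] at h5
  have h6 := h2.2.trans (mul_le_mul_of_nonneg_left h3 hD0)
  linarith

/-- Splitting the kernel `‖t‖ ^ (-b)` at radius `ρ` into its truncation and a compactly supported
singular part, the difference quotients fall on the density near the singularity and on the kernel
elsewhere. -/
theorem norm_fderiv_rieszPotential_le {f : E → ℝ} (h0 : ∀ y, 0 ≤ f y) (hf : Integrable f)
    (hd : Differentiable ℝ f) {b ρ L : ℝ} (hb : 0 < b) (hbd : b < Module.finrank ℝ E)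
    (hρ : 0 < ρ) {x : E} (hL : ∀ z ∈ ball x (2 * ρ), ‖fderiv ℝ f z‖ ≤ L) :
    ‖fderiv ℝ (fun x => ∫ y, f y * ‖x - y‖ ^ (-b)) x‖ ≤
      L * ((kernelMass E b + volume.real (ball (0 : E) 1)) * ρ ^ (Module.finrank ℝ E - b)) +
        b * ρ ^ (-b - 1) * ∫ y, f y := by
  have hL0 : 0 ≤ L := (norm_nonneg _).trans (hL x (mem_ball_self (by positivity)))
  have hF0 : 0 ≤ ∫ y, f y := integral_nonneg h0
  have hkm := kernelMass_nonneg (E := E) b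
  set d : ℝ := (Module.finrank ℝ E : ℝ) with hd_def
  set K₂ : E → ℝ := fun t => max ‖t‖ ρ ^ (-b) with hK₂
  set K₁ : E → ℝ := fun t => ‖t‖ ^ (-b) - K₂ t with hK₁
  have hmax : ∀ t : E, 0 < max ‖t‖ ρ := fun t => lt_max_of_lt_right hρ
  have hK₂0 : ∀ t, 0 ≤ K₂ t := fun t => Real.rpow_nonneg (hmax t).le _
  have hK₂ρ : ∀ t, K₂ t ≤ ρ ^ (-b) := fun t =>
    Real.rpow_le_rpow_of_nonpos hρ (le_max_right _ _) (by linarith)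
  have hK₂m : Measurable K₂ := by fun_prop
  have hG : Integrable ((ball (0 : E) ρ).indicator fun t => ‖t‖ ^ (-b) + ρ ^ (-b)) :=
    (integrable_indicator_iff measurableSet_ball).2
      ((integrableOn_ball_norm_rpow_neg hbd hρ).add (integrableOn_const measure_ball_lt_top.ne))
  have hGi : ∫ t, (ball (0 : E) ρ).indicator (fun t => ‖t‖ ^ (-b) + ρ ^ (-b)) t =
      (kernelMass E b + volume.real (ball (0 : E) 1)) * ρ ^ (d - b) := by
    rw [integral_indicator measurableSet_ball,
      integral_add (integrableOn_ball_norm_rpow_neg hbd hρ)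
        (integrableOn_const measure_ball_lt_top.ne), setIntegral_ball_norm_rpow_neg hρ,
      setIntegral_const, measureReal_def, Measure.addHaar_ball _ _ hρ.le,
      ENNReal.toReal_mul, ENNReal.toReal_ofReal (by positivity), ← measureReal_def, smul_eq_mul, ← Real.rpow_natCast,
      sub_eq_add_neg, Real.rpow_add hρ]
    ring
  have hint : ∀ x', Integrable (fun y => f y * ‖x' - y‖ ^ (-b)) := fun x' => by
    obtain ⟨M, hM⟩ := exists_le_on_closedBall hd.continuous x' 1
    exact (rieszPotential_le h0 hf hb.le hbd one_pos x'
      fun y hy => hM y (ball_subset_closedBall hy)).1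
  have hint₂ : ∀ x', Integrable (fun y => f y * K₂ (x' - y)) := fun x' => by
    refine (hf.mul_const (ρ ^ (-b))).mono' (hf.aestronglyMeasurable.mul
      (Measurable.aestronglyMeasurable (by fun_prop))) (ae_of_all _ fun y => ?_)
    rw [Real.norm_of_nonneg (mul_nonneg (h0 y) (hK₂0 _))]
    exact mul_le_mul_of_nonneg_left (hK₂ρ _) (h0 y)
  have hint₁ : ∀ x', Integrable (fun t => f (x' - t) * K₁ t) := fun x' => by
    have h := ((hint x').sub (hint₂ x')).comp_sub_left x'
    refine h.congr (ae_of_all _ fun t => ?_)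
    simp only [Pi.sub_apply, sub_sub_cancel, hK₁]
    ring
  have hsplit : ∀ x', ∫ y, f y * ‖x' - y‖ ^ (-b) =
      (∫ t, f (x' - t) * K₁ t) + ∫ y, f y * K₂ (x' - y) := fun x' => by
    rw [← integral_sub_left_eq_self (fun t => f (x' - t) * K₁ t) volume x', ← integral_add
      ((hint₁ x').comp_sub_left x') (hint₂ x')]
    refine integral_congr_ae (ae_of_all _ fun y => ?_)
    simp only [sub_sub_cancel, hK₁]
    ring
  refine norm_fderiv_le_of_lip' ℝ (by positivity) ?_
  filter_upwards [ball_mem_nhds x hρ] with x' hx'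
  have hx'ρ := mem_ball_iff_norm.1 hx'
  rw [hsplit x', hsplit x, add_sub_add_comm, ← integral_sub (hint₁ x') (hint₁ x),
    ← integral_sub (hint₂ x') (hint₂ x), add_mul]
  refine (norm_add_le _ _).trans (add_le_add ?_ ?_)
  · refine (norm_integral_le_of_norm_le (hG.const_mul (L * ‖x' - x‖))
      (ae_of_all _ fun t => ?_)).trans_eq ?_
    · rw [← sub_mul, norm_mul]
      by_cases ht : t ∈ ball (0 : E) ρ
      · rw [Set.indicator_of_mem ht]
        have htρ := mem_ball_zero_iff.1 ht
        refine mul_le_mul ?_ ?_ (norm_nonneg _) (by positivity)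
        · have h := (convex_ball x (2 * ρ)).norm_image_sub_le_of_norm_fderiv_le
            (fun z _ => hd z) hL (x := x - t) (y := x' - t)
            (by rw [mem_ball_iff_norm, sub_sub_cancel_left, norm_neg]; linarith)
            (by
              rw [mem_ball_iff_norm, sub_right_comm]
              linarith [norm_sub_le (x' - x) t])
          rwa [sub_sub_sub_cancel_right] at h
        · refine (norm_sub_le _ _).trans ?_
          rw [Real.norm_of_nonneg (by positivity), Real.norm_of_nonneg (hK₂0 t)]
          exact add_le_add_right (hK₂ρ t) _
      · rw [Set.indicator_of_notMem ht]
        rw [mem_ball_zero_iff, not_lt] at ht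
        simp [hK₁, hK₂, max_eq_left ht]
    · rw [integral_const_mul, hGi]
      ring
  · refine (norm_integral_le_of_norm_le (hf.const_mul (b * ρ ^ (-b - 1) * ‖x' - x‖))
      (ae_of_all _ fun y => ?_)).trans_eq ?_
    · rw [← mul_sub, norm_mul, Real.norm_of_nonneg (h0 y), mul_comm]
      refine mul_le_mul_of_nonneg_right ?_ (h0 y)
      refine (abs_rpow_neg_sub_rpow_neg_le hb hρ (le_max_right _ _) (le_max_right _ _)).trans ?_
      refine mul_le_mul_of_nonneg_left ?_ (by positivity)
      refine (abs_max_sub_max_le_abs _ _ _).trans ((abs_norm_sub_norm_le _ _).trans_eq ?_)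
      rw [sub_sub_sub_cancel_right]
    · rw [integral_const_mul]
      ring

theorem exists_norm_fderiv_rieszPotential_le {f : E → ℝ} (h0 : ∀ y, 0 ≤ f y) (hf : Integrable f)
    (hd : Differentiable ℝ f) {b A S : ℝ} (hb : 0 < b) (hbd : b < Module.finrank ℝ E)
    (hA : 0 ≤ A) (hfA : ∀ z, S ≤ ‖z‖ →
      ‖fderiv ℝ f z‖ ≤ A * (‖z‖ ^ (-(Module.finrank ℝ E : ℝ)) * ‖z‖⁻¹)) :
    ∃ D, 0 ≤ D ∧ ∀ x, max 4 (2 * S) ≤ ‖x‖ →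
      ‖fderiv ℝ (fun x => ∫ y, f y * ‖x - y‖ ^ (-b)) x‖ ≤ D * ‖x‖⁻¹ := by
  have hF0 : 0 ≤ ∫ y, f y := integral_nonneg h0
  have hkm := kernelMass_nonneg (E := E) b
  refine ⟨4 * (A * (kernelMass E b + volume.real (ball (0 : E) 1)) + b * ∫ y, f y),
    by positivity, fun x hx => ?_⟩
  have hx4 := (le_max_left _ _).trans hx
  have hxS := (le_max_right _ _).trans hx
  obtain ⟨ρ, hρx⟩ : ∃ ρ, ‖x‖ = 4 * ρ := ⟨‖x‖ / 4, by ring⟩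
  have hρ1 : 1 ≤ ρ := by linarith
  have hρ : 0 < ρ := by linarith
  set d : ℝ := (Module.finrank ℝ E : ℝ) with hd_def
  have h := norm_fderiv_rieszPotential_le h0 hf hd hb hbd hρ (x := x)
    (L := A * (ρ ^ (-d) * ρ⁻¹)) fun z hz => by
      have hz' : 2 * ρ ≤ ‖z‖ := by
        have := mem_ball_iff_norm'.1 hz
        linarith [norm_sub_norm_le x z]
      refine (hfA z (by linarith)).trans (mul_le_mul_of_nonneg_left ?_ hA)
      exact mul_le_mul (Real.rpow_le_rpow_of_nonpos hρ (by linarith) (by simp [hd_def]))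
        (inv_anti₀ hρ (by linarith)) (by positivity) (by positivity)
  refine h.trans ?_
  have h1 : ρ ^ (-d) * ρ ^ (d - b) = ρ ^ (-b) := by
    rw [← Real.rpow_add hρ]
    congr 1
    ring
  have h2 : ρ ^ (-b - 1) = ρ ^ (-b) * ρ⁻¹ := by
    rw [Real.rpow_sub_one hρ.ne', div_eq_mul_inv]
  have h3 : ρ ^ (-b) ≤ 1 := Real.rpow_le_one_of_one_le_of_nonpos hρ1 (by linarith)
  have h4 : (0 : ℝ) ≤ (A * (kernelMass E b + volume.real (ball (0 : E) 1)) + b * ∫ y, f y) * ρ⁻¹ :=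
    by positivity
  have h5 := mul_le_mul_of_nonneg_left h3 h4
  rw [h2, hρx, mul_inv]
  linear_combination h5 + A * (kernelMass E b + volume.real (ball (0 : E) 1)) * ρ⁻¹ * h1

end Gradient

section Coupled

variable {E : Type*} [NormedAddCommGroup E] [NormedSpace ℝ E] [FiniteDimensional ℝ E]
  [MeasureSpace E] [BorelSpace E] [Nontrivial E] [(volume : Measure E).IsAddHaarMeasure]

theorem finrank_lt_mul_integral_of_logPotential {m u : E → ℝ} (h0 : ∀ y, 0 ≤ m y)
    (hm : Integrable m) (hM : ∀ x, ∃ M, ∀ y ∈ ball x 1, m y ≤ M) {C k : ℝ} (hk : 0 < k)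
    (hu : ∀ x, u x = (∫ y, Real.log ((‖y‖ + 1) / ‖x - y‖) * m y) + C)
    (hf : Integrable fun y => exp (k * u y)) : Module.finrank ℝ E < k * ∫ y, m y := by
  by_contra! hα
  refine not_integrable_one_add_norm_rpow_neg_finrank (E := E)
    ((hf.const_mul (exp (-(k * C)))).mono'
      (Measurable.aestronglyMeasurable (by fun_prop)) (ae_of_all _ fun x => ?_))
  have hx := norm_nonneg x
  obtain ⟨M, hM⟩ := hM x
  have h := neg_log_mul_integral_le h0 hm x hM
  have hl : 0 ≤ Real.log (‖x‖ + 1) := Real.log_nonneg (by linarith)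
  rw [Real.norm_of_nonneg (by positivity), ← Real.exp_add, Real.rpow_def_of_pos (by positivity),
    add_comm 1 ‖x‖, hu x]
  refine Real.exp_le_exp.2 ?_
  have h1 := mul_le_mul_of_nonneg_left h hk.le
  have h2 := mul_le_mul_of_nonneg_right hα hl
  linarith

/-- Gradient decay for the coupled system in which `u` is the logarithmic potential of `c * v * f`,
where `f = exp (k * u)` and `v` is the Riesz potential of `f`. -/
theorem exists_norm_fderiv_le_of_coupled {u f v : E → ℝ} {b c C k : ℝ} (hb : 0 < b) (hc : 0 < c)
    (hk : 0 < k) (hd : 1 < Module.finrank ℝ E) (hbd : b < Module.finrank ℝ E)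
    (hud : Differentiable ℝ u) (hf : ∀ x, f x = exp (k * u x)) (hfi : Integrable f)
    (hv : ∀ x, v x = ∫ y, f y * ‖x - y‖ ^ (-b)) (hvf : Integrable fun y => v y * f y)
    (hu : ∀ x, u x = (∫ y, Real.log ((‖y‖ + 1) / ‖x - y‖) * (c * (v y * f y))) + C) :
    ∃ D S : ℝ, 0 < S ∧
      ∀ x, S ≤ ‖x‖ → ‖fderiv ℝ u x‖ ≤ D * ‖x‖⁻¹ ∧ ‖fderiv ℝ v x‖ ≤ D * ‖x‖⁻¹ := by
  have hf' : f = fun x => exp (k * u x) := funext hf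
  have hfd : Differentiable ℝ f := by rw [hf']; fun_prop
  have hf0 : ∀ y, 0 ≤ f y := fun y => by rw [hf]; positivity
  have hv0 : ∀ x, 0 ≤ v x := fun x => by
    rw [hv]
    exact integral_nonneg fun y => mul_nonneg (hf0 y) (by positivity)
  set m : E → ℝ := fun y => c * (v y * f y) with hm_def
  have hm0 : ∀ y, 0 ≤ m y := fun y => mul_nonneg hc.le (mul_nonneg (hv0 y) (hf0 y))
  have hmi : Integrable m := hvf.const_mul c
  have hmM : ∀ x, ∃ M, ∀ y ∈ ball x 1, m y ≤ M := fun x => by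
    obtain ⟨M₁, h₁⟩ := exists_le_on_closedBall hfd.continuous (0 : E) (‖x‖ + 1)
    obtain ⟨M₂, hM₂, h₂⟩ := exists_rieszPotential_le_on_closedBall hf0 hfi hfd.continuous hb.le hbd
      (‖x‖ + 1)
    refine ⟨c * (M₂ * M₁), fun y hy => ?_⟩
    have hy' : y ∈ closedBall (0 : E) (‖x‖ + 1) := by
      rw [mem_closedBall_zero_iff]
      linarith [mem_ball_iff_norm.1 hy, norm_le_norm_add_norm_sub' y x]
    exact mul_le_mul_of_nonneg_left
      (mul_le_mul ((hv y).trans_le (h₂ y hy')) (h₁ y hy') (hf0 y) hM₂) hc.le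
  have hα := finrank_lt_mul_integral_of_logPotential hm0 hmi hmM hk hu (by rwa [← hf'])
  obtain ⟨R, δ, A, hR0, hδ, hδη, hA, hRδ, hdec⟩ := exists_exp_mul_le_of_logPotential hm0 hmi hmM hk
    (η := (Module.finrank ℝ E - b) / (2 * k))
    (div_pos (sub_pos.2 hbd) (by positivity)) hu hα
  simp only [← hf] at hdec
  have hbk : b + k * δ < Module.finrank ℝ E := by
    rw [le_div_iff₀ (by positivity)] at hδη
    linarith
  obtain ⟨B, hB0, hB⟩ := exists_rieszPotential_le hf0 hfi hfd.continuous hm0 hmi hmM hb hk hδ hA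
    hbk hRδ fun z hz => (hdec z hz).trans (mul_le_mul_of_nonneg_right
      (mul_le_of_le_one_right hA (Real.rpow_le_one_of_one_le_of_nonpos (by linarith) (by simp)))
      (Real.exp_pos _).le)
  have hmB : ∀ y, m y ≤ c * B * f y := fun y => by
    rw [mul_assoc]
    exact mul_le_mul_of_nonneg_left
      (mul_le_mul_of_nonneg_right ((hv y).trans_le (hB y)) (hf0 y)) hc.le
  have hlocal : ∀ z, ∫ y in (closedBall (0 : E) R)ᶜ, max 0 (-Real.log ‖z - y‖) * m y ≤
      c * B / b * B := fun z => by
    obtain ⟨M, hM⟩ := hmM z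
    obtain ⟨M', hM'⟩ := exists_le_on_closedBall hfd.continuous z 1
    have hi := integrable_max_neg_log_mul hm0 hmi z hM
    have hr := (rieszPotential_le hf0 hfi hb.le hbd one_pos z
      fun y hy => hM' y (ball_subset_closedBall hy)).1
    refine (setIntegral_le_integral hi
      (ae_of_all _ fun y => mul_nonneg (le_max_left _ _) (hm0 y))).trans ?_
    refine (integral_mono hi (hr.const_mul (c * B / b)) fun y => ?_).trans ?_
    · refine (mul_le_mul (max_neg_log_le_rpow_neg_div (norm_nonneg _) hb) (hmB y) (hm0 y)
        (by positivity)).trans_eq ?_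
      ring
    · rw [integral_const_mul]
      exact mul_le_mul_of_nonneg_left (hB z) (by positivity)
  set A' := A * exp (k * (c * B / b * B)) with hA'
  have hA'0 : 0 ≤ A' := by positivity
  have hfA : ∀ z, 2 * (R + 1) ≤ ‖z‖ → f z ≤ A' * ‖z‖ ^ (-(Module.finrank ℝ E : ℝ)) :=
    fun z hz => by
      refine (hdec z hz).trans ?_
      rw [hA', mul_right_comm]
      refine mul_le_mul_of_nonneg_right (mul_le_mul_of_nonneg_left (Real.exp_le_exp.2 ?_) hA)
        (by positivity)
      exact mul_le_mul_of_nonneg_left (hlocal z) hk.le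
  obtain ⟨D₁, hD₁, hDu⟩ := exists_norm_fderiv_logPotential_le hm0 hmi hmM hd hu
    (A := c * B * A') (S := 2 * (R + 1)) (by positivity) (by positivity) fun z hz => by
      rw [mul_assoc _ A']
      exact (hmB z).trans (mul_le_mul_of_nonneg_left (hfA z hz) (by positivity))
  obtain ⟨D₂, hD₂, hDv⟩ := exists_norm_fderiv_rieszPotential_le hf0 hfi hfd hb hbd
    (A := k * A' * D₁) (S := 4 * (2 * (R + 1))) (by positivity) fun z hz => by
      have hfz : fderiv ℝ f z = f z • k • fderiv ℝ u z := by
        rw [hf z, hf']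
        exact (((hud z).hasFDerivAt.const_mul k).exp).fderiv
      rw [hfz, norm_smul, norm_smul, Real.norm_of_nonneg (hf0 z), Real.norm_of_nonneg hk.le]
      refine (mul_le_mul (hfA z (by linarith)) (mul_le_mul_of_nonneg_left (hDu z hz) hk.le)
        (by positivity) (by positivity)).trans_eq ?_
      ring
  rw [← show v = fun x => ∫ y, f y * ‖x - y‖ ^ (-b) from funext hv] at hDv
  refine ⟨max D₁ D₂, max 4 (2 * (4 * (2 * (R + 1)))), by positivity, fun x hx => ⟨?_, ?_⟩⟩
  · refine (hDu x ?_).trans (mul_le_mul_of_nonneg_right (le_max_left _ _) (by positivity))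
    linarith [(le_max_right _ _).trans hx]
  · exact (hDv x hx).trans (mul_le_mul_of_nonneg_right (le_max_right _ _) (by positivity))

end Coupled

theorem betaN_pos {n : ℕ} (hn : 0 < n) : 0 < betaN n := by
  have hn' : (0 : ℝ) < n := by exact_mod_cast hn
  have h1 : 0 < Real.Gamma ((n : ℝ) / 2 + 1) := Real.Gamma_pos_of_pos (by positivity)
  have h2 : 0 < Real.Gamma ((n : ℝ) / 2) := Real.Gamma_pos_of_pos (by positivity)
  have h3 : 0 < (volume (ball (0 : EuclideanSpace ℝ (Fin n)) 1)).toReal :=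
    ENNReal.toReal_pos (measure_ball_pos _ _ one_pos).ne' measure_ball_lt_top.ne
  unfold betaN
  positivity

theorem norm_gradient_eq_norm_fderiv {F : Type*} [NormedAddCommGroup F] [InnerProductSpace ℝ F]
    [CompleteSpace F] (f : F → ℝ) (x : F) : ‖gradient f x‖ = ‖fderiv ℝ f x‖ :=
  LinearIsometryEquiv.norm_map _ _

theorem gradient_decay (n : ℕ) (hn : 2 ≤ n) (μ : ℝ) (hμ0 : 0 < μ) (hμn : μ < n)
    (u : EuclideanSpace ℝ (Fin n) → ℝ) (hu : ContDiff ℝ n u)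
    (hB : CondB n μ u) (hIE : IE n μ u) :
    ∃ C > (0 : ℝ), ∃ R > (0 : ℝ), ∀ x : EuclideanSpace ℝ (Fin n), R ≤ ‖x‖ →
      ‖x‖ * ‖gradient u x‖ ≤ C ∧ ‖x‖ * ‖gradient (V n μ u) x‖ ≤ C := by
  obtain ⟨C, hC⟩ := hIE
  have hfin : Module.finrank ℝ (EuclideanSpace ℝ (Fin n)) = n := finrank_euclideanSpace_fin
  have : Nontrivial (EuclideanSpace ℝ (Fin n)) :=
    Module.nontrivial_of_finrank_pos (R := ℝ) (by omega)
  have hβ := betaN_pos (n := n) (by omega)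
  have hVf : Integrable fun x => V n μ u x * exp ((2 * n - μ) / 2 * u x) := by
    refine hB.2.integral_prod_left.congr (ae_of_all _ fun x => ?_)
    simp only [V]
    rw [← integral_mul_const]
    refine integral_congr_ae (ae_of_all _ fun y => ?_)
    ring
  obtain ⟨D, S, hS, h⟩ := exists_norm_fderiv_le_of_coupled (u := u)
    (f := fun x => exp ((2 * n - μ) / 2 * u x)) (v := V n μ u) (b := μ) (c := 1 / betaN n) (C := C)
    (k := (2 * n - μ) / 2) hμ0 (by positivity) (by linarith) (by omega) (by rwa [hfin])
    (hu.differentiable (by exact_mod_cast (by omega : n ≠ 0))) (fun _ => rfl) hB.1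
    (fun x => by simp only [V, div_eq_mul_inv, Real.rpow_neg (norm_nonneg _)]) hVf
    (fun x => by
      rw [hC x, ← integral_const_mul]
      congr 2
      funext y
      ring)
  refine ⟨max D 1, by positivity, S, hS, fun x hx => ?_⟩
  have hx0 : 0 < ‖x‖ := hS.trans_le hx
  have key : ∀ t : ℝ, t ≤ D * ‖x‖⁻¹ → ‖x‖ * t ≤ max D 1 := fun t ht => by
    have := mul_le_mul_of_nonneg_left ht hx0.le
    rw [mul_left_comm, mul_inv_cancel₀ hx0.ne', mul_one] at this
    exact this.trans (le_max_left _ _)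
  rw [norm_gradient_eq_norm_fderiv, norm_gradient_eq_norm_fderiv]
  exact ⟨key _ (h x hx).1, key _ (h x hx).2⟩
end
end
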